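/- arXiv:math/0507006 — 2 statements merged into one kernel-verified Lean document; each statement's English description precedes it below -/
import Mathlib

section
/- Let R ⊆ T be a sublattice possessing a ℤ-basis r₁,r₂,r₃,r₄ whose Gram matrix is [[-2,1,0,0],[1,-2,1,0],[0,1,-2,1],[0,0,1,-2]] (so R is isometric to A₄), and assume ρ(R) = R. Then T is the direct sum of R and its orthogonal complement R^⊥ = {v ∈ T : ⟨v,r⟩ = 0 for all r ∈ R}, and R^⊥ possesses a ℤ-basis whose Gram matrix is the block-diagonal matrix of U⊕V⊕A₄, i.e. R^⊥ is isometric to U⊕V⊕A₄. -/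
open Matrix

/-- Gram matrix of `T = U ⊕ V ⊕ A₄ ⊕ A₄` (block diagonal, in the basis
`e, f, x, y, e₁, …, e₄, e₁', …, e₄'`). -/
def G : Matrix (Fin 12) (Fin 12) ℤ :=
  !![0, 1, 0, 0, 0, 0, 0, 0, 0, 0, 0, 0;
     1, 0, 0, 0, 0, 0, 0, 0, 0, 0, 0, 0;
     0, 0, 2, 1, 0, 0, 0, 0, 0, 0, 0, 0;
     0, 0, 1, -2, 0, 0, 0, 0, 0, 0, 0, 0;
     0, 0, 0, 0, -2, 1, 0, 0, 0, 0, 0, 0;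
     0, 0, 0, 0, 1, -2, 1, 0, 0, 0, 0, 0;
     0, 0, 0, 0, 0, 1, -2, 1, 0, 0, 0, 0;
     0, 0, 0, 0, 0, 0, 1, -2, 0, 0, 0, 0;
     0, 0, 0, 0, 0, 0, 0, 0, -2, 1, 0, 0;
     0, 0, 0, 0, 0, 0, 0, 0, 1, -2, 1, 0;
     0, 0, 0, 0, 0, 0, 0, 0, 0, 1, -2, 1;
     0, 0, 0, 0, 0, 0, 0, 0, 0, 0, 1, -2]

/-- The matrix of `ρ = ρ₀ ⊕ ρ₄ ⊕ ρ₄` (block diagonal). -/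
def ρ : Matrix (Fin 12) (Fin 12) ℤ :=
  !![0, -1, 0, 0, 0, 0, 0, 0, 0, 0, 0, 0;
     -1, -1, 1, 3, 0, 0, 0, 0, 0, 0, 0, 0;
     0, 0, -1, -1, 0, 0, 0, 0, 0, 0, 0, 0;
     0, -1, 0, 1, 0, 0, 0, 0, 0, 0, 0, 0;
     0, 0, 0, 0, 0, 0, 0, -1, 0, 0, 0, 0;
     0, 0, 0, 0, 1, 0, 0, -1, 0, 0, 0, 0;
     0, 0, 0, 0, 0, 1, 0, -1, 0, 0, 0, 0;
     0, 0, 0, 0, 0, 0, 1, -1, 0, 0, 0, 0;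
     0, 0, 0, 0, 0, 0, 0, 0, 0, 0, 0, -1;
     0, 0, 0, 0, 0, 0, 0, 0, 1, 0, 0, -1;
     0, 0, 0, 0, 0, 0, 0, 0, 0, 1, 0, -1;
     0, 0, 0, 0, 0, 0, 0, 0, 0, 0, 1, -1]

/-- The bilinear form of the lattice `T`: `⟨u, v⟩ = uᵀ G v`. -/
def B (u v : Fin 12 → ℤ) : ℤ := u ⬝ᵥ G.mulVec v

/-- Gram matrix of the root lattice `A₄`. -/
def A4gram : Matrix (Fin 4) (Fin 4) ℤ :=
  !![-2, 1, 0, 0;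
     1, -2, 1, 0;
     0, 1, -2, 1;
     0, 0, 1, -2]

/-- Gram matrix of `U ⊕ V ⊕ A₄` (block diagonal). -/
def G₈ : Matrix (Fin 8) (Fin 8) ℤ :=
  !![0, 1, 0, 0, 0, 0, 0, 0;
     1, 0, 0, 0, 0, 0, 0, 0;
     0, 0, 2, 1, 0, 0, 0, 0;
     0, 0, 1, -2, 0, 0, 0, 0;
     0, 0, 0, 0, -2, 1, 0, 0;
     0, 0, 0, 0, 1, -2, 1, 0;
     0, 0, 0, 0, 0, 1, -2, 1;
     0, 0, 0, 0, 0, 0, 1, -2]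


/-! ## The ring `ℤ[ζ₅]` -/

/-- The element `a + b ζ + c ζ² + d ζ³` of `ℤ[ζ₅]`. -/
@[ext] structure Z5 where
  a : ℤ
  b : ℤ
  c : ℤ
  d : ℤ

namespace Z5

instance : Zero Z5 := ⟨⟨0, 0, 0, 0⟩⟩
instance : One Z5 := ⟨⟨1, 0, 0, 0⟩⟩
instance : Add Z5 := ⟨fun x y => ⟨x.a + y.a, x.b + y.b, x.c + y.c, x.d + y.d⟩⟩
instance : Neg Z5 := ⟨fun x => ⟨-x.a, -x.b, -x.c, -x.d⟩⟩
instance : Sub Z5 := ⟨fun x y => ⟨x.a - y.a, x.b - y.b, x.c - y.c, x.d - y.d⟩⟩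
instance : Mul Z5 := ⟨fun x y =>
  ⟨x.a * y.a + x.c * y.d + x.d * y.c - (x.b * y.d + x.c * y.c + x.d * y.b),
   x.a * y.b + x.b * y.a + x.d * y.d - (x.b * y.d + x.c * y.c + x.d * y.b),
   x.a * y.c + x.b * y.b + x.c * y.a - (x.b * y.d + x.c * y.c + x.d * y.b),
   x.a * y.d + x.b * y.c + x.c * y.b + x.d * y.a - (x.b * y.d + x.c * y.c + x.d * y.b)⟩⟩
instance : IntCast Z5 := ⟨fun n => ⟨n, 0, 0, 0⟩⟩
instance : NatCast Z5 := ⟨fun n => ⟨n, 0, 0, 0⟩⟩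

@[simp] lemma zero_a : (0 : Z5).a = 0 := rfl
@[simp] lemma zero_b : (0 : Z5).b = 0 := rfl
@[simp] lemma zero_c : (0 : Z5).c = 0 := rfl
@[simp] lemma zero_d : (0 : Z5).d = 0 := rfl
@[simp] lemma one_a : (1 : Z5).a = 1 := rfl
@[simp] lemma one_b : (1 : Z5).b = 0 := rfl
@[simp] lemma one_c : (1 : Z5).c = 0 := rfl
@[simp] lemma one_d : (1 : Z5).d = 0 := rfl
@[simp] lemma add_a (x y : Z5) : (x + y).a = x.a + y.a := rfl
@[simp] lemma add_b (x y : Z5) : (x + y).b = x.b + y.b := rfl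
@[simp] lemma add_c (x y : Z5) : (x + y).c = x.c + y.c := rfl
@[simp] lemma add_d (x y : Z5) : (x + y).d = x.d + y.d := rfl
@[simp] lemma sub_a (x y : Z5) : (x - y).a = x.a - y.a := rfl
@[simp] lemma sub_b (x y : Z5) : (x - y).b = x.b - y.b := rfl
@[simp] lemma sub_c (x y : Z5) : (x - y).c = x.c - y.c := rfl
@[simp] lemma sub_d (x y : Z5) : (x - y).d = x.d - y.d := rfl
@[simp] lemma neg_a (x : Z5) : (-x).a = -x.a := rfl
@[simp] lemma neg_b (x : Z5) : (-x).b = -x.b := rfl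
@[simp] lemma neg_c (x : Z5) : (-x).c = -x.c := rfl
@[simp] lemma neg_d (x : Z5) : (-x).d = -x.d := rfl
@[simp] lemma mul_a (x y : Z5) : (x * y).a =
  x.a * y.a + x.c * y.d + x.d * y.c - (x.b * y.d + x.c * y.c + x.d * y.b) := rfl
@[simp] lemma mul_b (x y : Z5) : (x * y).b =
  x.a * y.b + x.b * y.a + x.d * y.d - (x.b * y.d + x.c * y.c + x.d * y.b) := rfl
@[simp] lemma mul_c (x y : Z5) : (x * y).c =
  x.a * y.c + x.b * y.b + x.c * y.a - (x.b * y.d + x.c * y.c + x.d * y.b) := rfl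
@[simp] lemma mul_d (x y : Z5) : (x * y).d =
  x.a * y.d + x.b * y.c + x.c * y.b + x.d * y.a - (x.b * y.d + x.c * y.c + x.d * y.b) := rfl

instance : CommRing Z5 where
  add_assoc x y z := by ext <;> simp <;> ring
  zero_add x := by ext <;> simp
  add_zero x := by ext <;> simp
  add_comm x y := by ext <;> simp <;> ring
  left_distrib x y z := by ext <;> simp <;> ring
  right_distrib x y z := by ext <;> simp <;> ring
  zero_mul x := by ext <;> simp
  mul_zero x := by ext <;> simp
  mul_assoc x y z := by ext <;> simp <;> ring
  one_mul x := by ext <;> simp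
  mul_one x := by ext <;> simp
  neg_add_cancel x := by ext <;> simp
  mul_comm x y := by ext <;> simp <;> ring
  sub_eq_add_neg x y := by ext <;> simp <;> ring
  nsmul := nsmulRec
  zsmul := zsmulRec
  natCast_zero := by ext <;> rfl
  natCast_succ n := by ext <;> simp [NatCast.natCast]
  intCast_ofNat n := by ext <;> rfl
  intCast_negSucc n := by ext <;> rfl

@[simp] lemma intCast_a (n : ℤ) : ((n : ℤ) : Z5).a = n := rfl
@[simp] lemma intCast_b (n : ℤ) : ((n : ℤ) : Z5).b = 0 := rfl
@[simp] lemma intCast_c (n : ℤ) : ((n : ℤ) : Z5).c = 0 := rfl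
@[simp] lemma intCast_d (n : ℤ) : ((n : ℤ) : Z5).d = 0 := rfl

/-- complex conjugation -/
def cj : Z5 →+* Z5 where
  toFun x := ⟨x.a - x.b, -x.b, x.d - x.b, x.c - x.b⟩
  map_one' := by ext <;> simp
  map_zero' := by ext <;> simp
  map_add' x y := by ext <;> simp <;> ring
  map_mul' x y := by ext <;> simp <;> ring

@[simp] lemma cj_a (x : Z5) : (cj x).a = x.a - x.b := rfl
@[simp] lemma cj_b (x : Z5) : (cj x).b = -x.b := rfl
@[simp] lemma cj_c (x : Z5) : (cj x).c = x.d - x.b := rfl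
@[simp] lemma cj_d (x : Z5) : (cj x).d = x.c - x.b := rfl
@[simp] lemma cj_cj (x : Z5) : cj (cj x) = x := by ext <;> simp

/-- real elements -/
def IsR (x : Z5) : Prop := x.b = 0 ∧ x.d = x.c

lemma isR_iff (x : Z5) : IsR x ↔ cj x = x := by
  constructor
  · rintro ⟨h1, h2⟩; ext <;> simp [h1, h2]
  · intro h
    have h1 := congrArg Z5.a h
    have h2 := congrArg Z5.c h
    simp at h1 h2
    exact ⟨h1, by omega⟩

lemma IsR.mul {x y : Z5} (hx : IsR x) (hy : IsR y) : IsR (x * y) := by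
  rw [isR_iff] at *; rw [map_mul, hx, hy]
lemma isR_norm (x : Z5) : IsR (x * cj x) := by
  rw [isR_iff, map_mul, cj_cj, mul_comm]

/-- Galois conjugate of a real element -/
def tl (x : Z5) : Z5 := ⟨x.a - x.c, 0, -x.c, -x.c⟩
lemma isR_tl (x : Z5) : IsR (tl x) := ⟨rfl, rfl⟩
/-- norm of a real element -/
def Nm (x : Z5) : ℤ := x.a * x.a - x.a * x.c - x.c * x.c

lemma mul_tl {x : Z5} (hx : IsR x) : x * tl x = (Nm x : ℤ) := by
  obtain ⟨h1, h2⟩ := hx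
  ext <;> simp [tl, Nm, h1, h2] <;> ring

/-- the real part of `x` at the place where `ζ + ζ⁻¹ = g` -/
noncomputable def P (g : ℝ) (x : Z5) : ℝ := x.a + x.b * (g / 2) + (x.c + x.d) * ((-1 - g) / 2)

lemma P_add (g : ℝ) (x y : Z5) : P g (x + y) = P g x + P g y := by simp [P]; ring
lemma P_sub (g : ℝ) (x y : Z5) : P g (x - y) = P g x - P g y := by simp [P]; ring
lemma P_neg (g : ℝ) (x : Z5) : P g (-x) = - P g x := by simp [P]; ring
lemma P_zero (g : ℝ) : P g 0 = 0 := by simp [P]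
lemma P_one (g : ℝ) : P g 1 = 1 := by simp [P]
lemma P_int (g : ℝ) (n : ℤ) : P g (n : Z5) = n := by simp [P]
lemma P_mul {g : ℝ} (hg : g ^ 2 + g = 1) {x : Z5} (hx : IsR x) (y : Z5) :
    P g (x * y) = P g x * P g y := by
  obtain ⟨h1, h2⟩ := hx
  simp only [P, mul_a, mul_b, mul_c, mul_d, h1, h2]
  push_cast
  linear_combination (-(x.c : ℝ) * (y.b / 2 - (y.c + y.d) / 2) * (-1)) * hg

lemma P_normSq {g : ℝ} (hg : g ^ 2 + g = 1) (x : Z5) : P g (x * cj x) =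
    (P g x) ^ 2 + (4 - g ^ 2) / 4 * (x.b + (x.c - x.d) * g) ^ 2 := by
  simp only [P, mul_a, mul_b, mul_c, mul_d, cj_a, cj_b, cj_c, cj_d]
  push_cast
  have h3 : g ^ 3 = 2 * g - 1 := by linear_combination (g - 1) * hg
  have h4 : g ^ 4 = 2 - 3 * g := by linear_combination (g ^ 2 - g + 2) * hg
  linear_combination -((x.b - (x.c + x.d : ℝ)) ^ 2 / 4 + (x.c - x.d : ℝ) ^ 2 - x.b ^ 2 / 4) * hg
    + (x.b * (x.c - x.d : ℝ) / 2) * h3 + ((x.c - x.d : ℝ) ^ 2 / 4) * h4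

end Z5
namespace Z5

lemma P_norm_nonneg {g : ℝ} (hg : g ^ 2 + g = 1) (h4 : g ^ 2 ≤ 4) (x : Z5) : 0 ≤ P g (x * cj x) := by
  rw [P_normSq hg]
  have : 0 ≤ (4 - g ^ 2) / 4 := by linarith
  positivity

/-- first place -/
noncomputable def g1 : ℝ := (√5 - 1) / 2
/-- second place -/
noncomputable def g2 : ℝ := (-√5 - 1) / 2

lemma g2_eq : g2 = -1 - g1 := by simp only [g1, g2]; ring
lemma hg1 : g1 ^ 2 + g1 = 1 := by
  have := Real.sq_sqrt (show (0:ℝ) ≤ 5 by norm_num)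
  simp only [g1]; linear_combination this / 4
lemma hg2 : g2 ^ 2 + g2 = 1 := by
  rw [g2_eq]; linear_combination hg1
lemma g1_lb : 0.618 < g1 := by
  have : (2.236 : ℝ) < √5 := Real.lt_sqrt_of_sq_lt (by norm_num)
  simp only [g1]; linarith
lemma g1_ub : g1 < 0.6181 := by
  have : √5 < (2.2362 : ℝ) := by rw [Real.sqrt_lt' (by norm_num)]; norm_num
  simp only [g1]; linarith
lemma g1_irr : Irrational g1 := by
  have h : Irrational (√5) := by
    have := Nat.Prime.irrational_sqrt (show Nat.Prime 5 by norm_num)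
    exact_mod_cast this
  intro ⟨q, hq⟩
  apply h
  refine ⟨2 * q + 1, ?_⟩
  push_cast
  rw [hq, g1]; ring

lemma P1_nonneg (x : Z5) : 0 ≤ P g1 (x * cj x) :=
  P_norm_nonneg hg1 (by nlinarith [g1_lb, g1_ub]) x
lemma P2_nonneg (x : Z5) : 0 ≤ P g2 (x * cj x) :=
  P_norm_nonneg hg2 (by rw [g2_eq]; nlinarith [g1_lb, g1_ub]) x

lemma PP {x : Z5} (hx : IsR x) : P g1 x * P g2 x = Nm x := by
  obtain ⟨h1, h2⟩ := hx
  simp only [P, Nm, g2_eq, h1, h2]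
  push_cast
  linear_combination (-(x.c : ℝ) ^ 2) * hg1

lemma P_tl1 {x : Z5} (hx : IsR x) : P g1 (tl x) = P g2 x := by
  obtain ⟨h1, h2⟩ := hx
  simp only [P, tl, g2_eq, h1, h2]
  push_cast
  ring
lemma P_tl2 {x : Z5} (hx : IsR x) : P g2 (tl x) = P g1 x := by
  obtain ⟨h1, h2⟩ := hx
  simp only [P, tl, g2_eq, h1, h2]
  push_cast
  ring

lemma P1_eq_zero {x : Z5} (hx : IsR x) (h : P g1 x = 0) : x = 0 := by
  obtain ⟨h1, h2⟩ := hx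
  have hc : x.c = 0 := by
    by_contra hc
    apply g1_irr
    refine ⟨(x.a - x.c : ℚ) / x.c, ?_⟩
    push_cast
    have : (x.c : ℝ) ≠ 0 := by exact_mod_cast hc
    field_simp
    simp only [P, h1, h2] at h
    push_cast at h
    linarith
  have ha : x.a = 0 := by
    simp [P, h1, h2, hc] at h
    exact h
  ext <;> simp [*]

lemma tl_eq_zero {x : Z5} (hx : IsR x) (h : tl x = 0) : x = 0 := by
  obtain ⟨h1, h2⟩ := hx
  have e1 := congrArg Z5.a h
  have e2 := congrArg Z5.c h
  simp only [tl, zero_a, zero_c] at e1 e2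
  ext <;> simp [*] <;> omega

lemma P2_eq_zero {x : Z5} (hx : IsR x) (h : P g2 x = 0) : x = 0 := by
  rw [← P_tl1 hx] at h
  exact tl_eq_zero hx (P1_eq_zero (isR_tl x) h)

/-- the trace form -/
def Q (x : Z5) : ℤ := 5 * (x.a ^ 2 + x.b ^ 2 + x.c ^ 2 + x.d ^ 2) - (x.a + x.b + x.c + x.d) ^ 2

lemma Q_eq (x : Z5) : (Q x : ℝ) = 2 * (P g1 (x * cj x) + P g2 (x * cj x)) := by
  simp only [P, Q, g2_eq, mul_a, mul_b, mul_c, mul_d, cj_a, cj_b, cj_c, cj_d]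
  push_cast
  ring

lemma eq_zero_of_norm {x : Z5} (h : x * cj x = 0) : x = 0 := by
  have hQ : (Q x : ℝ) = 0 := by rw [Q_eq, h, P_zero, P_zero]; simp
  have hQ : Q x = 0 := by exact_mod_cast hQ
  have : Q x = x.a ^ 2 + x.b ^ 2 + x.c ^ 2 + x.d ^ 2 + (x.a - x.b) ^ 2 + (x.a - x.c) ^ 2
    + (x.a - x.d) ^ 2 + (x.b - x.c) ^ 2 + (x.b - x.d) ^ 2 + (x.c - x.d) ^ 2 := by
    simp only [Q]; ring
  have ha : x.a = 0 := by
    have : x.a ^ 2 = 0 := by nlinarith [sq_nonneg x.a, sq_nonneg x.b, sq_nonneg x.c, sq_nonneg x.d, sq_nonneg (x.a - x.b), sq_nonneg (x.a - x.c), sq_nonneg (x.a - x.d), sq_nonneg (x.b - x.c), sq_nonneg (x.b - x.d), sq_nonneg (x.c - x.d)]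
    simpa using this
  have hb : x.b = 0 := by
    have : x.b ^ 2 = 0 := by nlinarith [sq_nonneg x.a, sq_nonneg x.b, sq_nonneg x.c, sq_nonneg x.d, sq_nonneg (x.a - x.b), sq_nonneg (x.a - x.c), sq_nonneg (x.a - x.d), sq_nonneg (x.b - x.c), sq_nonneg (x.b - x.d), sq_nonneg (x.c - x.d)]
    simpa using this
  have hc : x.c = 0 := by
    have : x.c ^ 2 = 0 := by nlinarith [sq_nonneg x.a, sq_nonneg x.b, sq_nonneg x.c, sq_nonneg x.d, sq_nonneg (x.a - x.b), sq_nonneg (x.a - x.c), sq_nonneg (x.a - x.d), sq_nonneg (x.b - x.c), sq_nonneg (x.b - x.d), sq_nonneg (x.c - x.d)]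
    simpa using this
  have hd : x.d = 0 := by
    have : x.d ^ 2 = 0 := by nlinarith [sq_nonneg x.a, sq_nonneg x.b, sq_nonneg x.c, sq_nonneg x.d, sq_nonneg (x.a - x.b), sq_nonneg (x.a - x.c), sq_nonneg (x.a - x.d), sq_nonneg (x.b - x.c), sq_nonneg (x.b - x.d), sq_nonneg (x.c - x.d)]
    simpa using this
  ext <;> simp [*]

lemma P1_pos {x : Z5} (hx : x ≠ 0) : 0 < P g1 (x * cj x) :=
  lt_of_le_of_ne (P1_nonneg x) fun h => hx (eq_zero_of_norm (P1_eq_zero (isR_norm x) h.symm))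
lemma P2_pos {x : Z5} (hx : x ≠ 0) : 0 < P g2 (x * cj x) :=
  lt_of_le_of_ne (P2_nonneg x) fun h => hx (eq_zero_of_norm (P2_eq_zero (isR_norm x) h.symm))

/-- absolute norm -/
def N (x : Z5) : ℤ := Nm (x * cj x)

lemma N_eq (x : Z5) : (N x : ℝ) = P g1 (x * cj x) * P g2 (x * cj x) := (PP (isR_norm x)).symm
lemma N_nonneg (x : Z5) : 0 ≤ N x := by
  have : (0 : ℝ) ≤ N x := by rw [N_eq]; exact mul_nonneg (P1_nonneg x) (P2_nonneg x)
  exact_mod_cast this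
lemma N_pos {x : Z5} (hx : x ≠ 0) : 0 < N x := by
  have : (0 : ℝ) < N x := by rw [N_eq]; exact mul_pos (P1_pos hx) (P2_pos hx)
  exact_mod_cast this

/-- norm at a place is multiplicative -/
lemma Pn_mul {g : ℝ} (hg : g ^ 2 + g = 1) (x y : Z5) :
    P g ((x * y) * cj (x * y)) = P g (x * cj x) * P g (y * cj y) := by
  rw [← P_mul hg (isR_norm x), map_mul]
  congr 1; ring

lemma N_mul (x y : Z5) : N (x * y) = N x * N y := by
  have : (N (x * y) : ℝ) = N x * N y := by
    rw [N_eq, N_eq, N_eq, Pn_mul hg1, Pn_mul hg2]; ring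
  exact_mod_cast this

lemma N_zero : N 0 = 0 := by simp [N, Nm]
lemma N_one : N 1 = 1 := by simp [N, Nm]

lemma N_le (x : Z5) : 16 * N x ≤ Q x ^ 2 := by
  have : (16 : ℝ) * N x ≤ (Q x : ℝ) ^ 2 := by
    rw [N_eq, Q_eq]; nlinarith [sq_nonneg (P g1 (x * cj x) - P g2 (x * cj x))]
  exact_mod_cast this

/-- quadratic form on five coordinates -/
def Q5 (c : Fin 5 → ℤ) : ℤ := 5 * ∑ i, c i ^ 2 - (∑ i, c i) ^ 2

lemma Q5_perm (c : Fin 5 → ℤ) (s : Equiv.Perm (Fin 5)) : Q5 (c ∘ s) = Q5 c := by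
  simp only [Q5, Function.comp]
  rw [Equiv.sum_comp s c, Equiv.sum_comp s (fun i => c i ^ 2)]

lemma cover_sorted (n a b c d e : ℤ) (hn : 0 < n) (h1 : a ≤ b) (h2 : b ≤ c) (h3 : c ≤ d)
    (h4 : d ≤ e) (h5 : e ≤ a + n) :
    ∃ k : Fin 5 → ℤ, Q5 (fun i => ![a, b, c, d, e] i + n * k i) ≤ 2 * n ^ 2 := by
  by_contra hcon
  push Not at hcon
  have q0 := hcon ![0, 0, 0, 0, 0]
  have q1 := hcon ![1, 0, 0, 0, 0]
  have q2 := hcon ![1, 1, 0, 0, 0]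
  have q3 := hcon ![1, 1, 1, 0, 0]
  have q4 := hcon ![1, 1, 1, 1, 0]
  simp only [Q5, Fin.sum_univ_five] at q0 q1 q2 q3 q4
  simp at q0 q1 q2 q3 q4
  have w0 := mul_le_mul_of_nonneg_left (Int.add_one_le_of_lt q0) (show 0 ≤ n - (e - a) by linarith)
  have w1 := mul_le_mul_of_nonneg_left (Int.add_one_le_of_lt q1) (show 0 ≤ b - a by linarith)
  have w2 := mul_le_mul_of_nonneg_left (Int.add_one_le_of_lt q2) (show 0 ≤ c - b by linarith)
  have w3 := mul_le_mul_of_nonneg_left (Int.add_one_le_of_lt q3) (show 0 ≤ d - c by linarith)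
  have w4 := mul_le_mul_of_nonneg_left (Int.add_one_le_of_lt q4) (show 0 ≤ e - d by linarith)
  clear hcon q0 q1 q2 q3 q4
  have key : 0 ≤ n * ((5 * (b - a) - n) ^ 2 + (5 * (c - b) - n) ^ 2 + (5 * (d - c) - n) ^ 2
    + (5 * (e - d) - n) ^ 2 + (5 * (n - (e - a)) - n) ^ 2 + (5 * (c - a) - 2 * n) ^ 2
    + (5 * (d - b) - 2 * n) ^ 2 + (5 * (e - c) - 2 * n) ^ 2 + (5 * (n - (d - a)) - 2 * n) ^ 2
    + (5 * (n - (e - b)) - 2 * n) ^ 2) := by positivity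
  linarith only [key, w0, w1, w2, w3, w4, hn]

lemma cover (z : Z5) (n : ℤ) (hn : 0 < n) : ∃ x : Z5, Q (z + n * x) ≤ 2 * n ^ 2 := by
  let c : Fin 5 → ℤ := ![z.a % n, z.b % n, z.c % n, z.d % n, 0]
  have hc0 : ∀ i, 0 ≤ c i := by
    intro i; fin_cases i <;> simp [c] <;> exact Int.emod_nonneg _ hn.ne'
  have hcn : ∀ i, c i ≤ n := by
    intro i; fin_cases i <;> simp [c] <;> first | exact (Int.emod_lt_of_pos _ hn).le | exact hn.le
  let s := Tuple.sort c
  have hs : Monotone (c ∘ s) := Tuple.monotone_sort c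
  obtain ⟨k, hk⟩ := cover_sorted n (c (s 0)) (c (s 1)) (c (s 2)) (c (s 3)) (c (s 4)) hn
    (hs (by decide : (0 : Fin 5) ≤ 1)) (hs (by decide : (1 : Fin 5) ≤ 2))
    (hs (by decide : (2 : Fin 5) ≤ 3)) (hs (by decide : (3 : Fin 5) ≤ 4))
    (by linarith [hc0 (s 0), hcn (s 4)])
  have e1 : (fun i => ![c (s 0), c (s 1), c (s 2), c (s 3), c (s 4)] i + n * k i)
      = (fun i => c i + n * k (s.symm i)) ∘ s := by
    funext i; fin_cases i <;> simp
  rw [e1, Q5_perm] at hk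
  set l : Fin 5 → ℤ := fun i => k (s.symm i) with hl
  refine ⟨⟨l 0 - z.a / n - l 4, l 1 - z.b / n - l 4, l 2 - z.c / n - l 4, l 3 - z.d / n - l 4⟩, ?_⟩
  refine le_trans (le_of_eq ?_) hk
  have ea := Int.emod_add_mul_ediv z.a n
  have eb := Int.emod_add_mul_ediv z.b n
  have ec := Int.emod_add_mul_ediv z.c n
  have ed := Int.emod_add_mul_ediv z.d n
  simp only [Q, Q5, Fin.sum_univ_five, c]
  simp
  generalize z.a / n = qa at *
  generalize z.b / n = qb at *
  generalize z.c / n = qc at *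
  generalize z.d / n = qd at *
  generalize z.a % n = ra at *
  generalize z.b % n = rb at *
  generalize z.c % n = rc at *
  generalize z.d % n = rd at *
  rw [← ea, ← eb, ← ec, ← ed]
  ring

lemma cover' (z : Z5) (n : ℤ) (hn : n ≠ 0) : ∃ x : Z5, Q (z + n * x) ≤ 2 * n ^ 2 := by
  rcases lt_or_gt_of_ne hn with h | h
  · obtain ⟨x, hx⟩ := cover z (-n) (by omega)
    refine ⟨-x, ?_⟩
    have : z + n * -x = z + (-n : ℤ) * x := by push_cast; ring
    rw [this]; simpa using hx
  · exact cover z n h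

lemma N_intCast (n : ℤ) : N (n : Z5) = n ^ 4 := by
  simp only [N, Nm]; simp; ring

lemma euclid (z w : Z5) (hw : w ≠ 0) : ∃ x : Z5, N (z - w * x) < N w := by
  set W := cj w * tl (w * cj w) with hW
  have hwW : w * W = (N w : ℤ) := by
    rw [hW, N, ← mul_tl (isR_norm w)]; ring
  have hn := N_pos hw
  obtain ⟨x, hx⟩ := cover' (z * W) (N w) hn.ne'
  refine ⟨-x, ?_⟩
  have h1 : z * W + (N w : ℤ) * x = (z - w * -x) * W := by rw [← hwW]; ring
  have h2 := N_le (z * W + (N w : ℤ) * x)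
  have h3 : N w * N W = N w ^ 4 := by rw [← N_mul, hwW, N_intCast]
  have h4 : N W = N w ^ 3 := by
    apply mul_left_cancel₀ hn.ne'; rw [h3]; ring
  have hQ0 : 0 ≤ Q (z * W + (N w : ℤ) * x) := by
    have : (0:ℝ) ≤ Q (z * W + (N w : ℤ) * x) := by
      rw [Q_eq]; linarith [P1_nonneg (z * W + (N w : ℤ) * x), P2_nonneg (z * W + (N w : ℤ) * x)]
    exact_mod_cast this
  have h5 : Q (z * W + (N w : ℤ) * x) ^ 2 ≤ (2 * N w ^ 2) ^ 2 := pow_le_pow_left₀ hQ0 hx 2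
  rw [h1] at h2 h5
  rw [N_mul, h4] at h2
  by_contra hcon
  push Not at hcon
  have h6 : N w * N w ^ 3 ≤ N (z - w * -x) * N w ^ 3 :=
    mul_le_mul_of_nonneg_right hcon (by positivity)
  have : 0 < N w ^ 4 := by positivity
  nlinarith

instance : Nontrivial Z5 := ⟨0, 1, fun h => by simpa using congrArg Z5.a h⟩

instance : NoZeroDivisors Z5 := ⟨by
  intro x y h
  by_contra hcon
  push Not at hcon
  have := mul_pos (N_pos hcon.1) (N_pos hcon.2)
  rw [← N_mul, h, N_zero] at this
  exact lt_irrefl _ this⟩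

instance : IsDomain Z5 := NoZeroDivisors.to_isDomain Z5

open Classical in
/-- the Euclidean structure -/
@[reducible] noncomputable def euc : EuclideanDomain Z5 :=
  { (inferInstance : CommRing Z5), (inferInstance : Nontrivial Z5) with
    quotient := fun z w => if hw : w = 0 then 0 else (euclid z w hw).choose
    remainder := fun z w => z - w * (if hw : w = 0 then 0 else (euclid z w hw).choose)
    quotient_zero := fun z => by simp
    quotient_mul_add_remainder_eq := fun z w => by ring
    r := fun x y => (N x).toNat < (N y).toNat
    r_wellFounded := InvImage.wf (fun x => (N x).toNat) Nat.lt_wfRel.wf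
    remainder_lt := fun z w hw => by
      have := (euclid z w hw).choose_spec
      rw [dif_neg hw]
      have h2 := N_nonneg (z - w * (euclid z w hw).choose)
      omega
    mul_left_not_lt := fun x y hy => by
      have h1 := N_pos hy
      have h2 := N_nonneg x
      rw [N_mul]
      have : N x ≤ N x * N y := by nlinarith
      omega }

instance : IsPrincipalIdealRing Z5 := by
  let _ := euc
  exact EuclideanDomain.to_principal_ideal_domain

end Z5
namespace Z5

/-- the unit `1 + ζ` -/
def xi : Z5ˣ where
  val := ⟨1, 1, 0, 0⟩
  inv := ⟨0, -1, 0, -1⟩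
  val_inv := by ext <;> simp
  inv_val := by ext <;> simp

/-- the norm at the place `g` -/
noncomputable def PN (g : ℝ) (hg : g ^ 2 + g = 1) : Z5 →* ℝ where
  toFun x := P g (x * cj x)
  map_one' := by simp [P_one]
  map_mul' x y := Pn_mul hg x y

lemma PN_xi_zpow (g : ℝ) (hg : g ^ 2 + g = 1) (k : ℤ) :
    P g ((xi ^ k : Z5ˣ) * cj (xi ^ k : Z5ˣ)) = (2 + g) ^ k := by
  have h := map_zpow (Units.map (PN g hg)) xi k
  have h2 := congrArg Units.val h
  rw [Units.val_zpow_eq_zpow_val] at h2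
  have h3 : ((Units.map (PN g hg) xi : ℝˣ) : ℝ) = 2 + g := by
    change P g (xi.val * cj xi.val) = 2 + g
    simp [P, xi]; ring
  rw [h3] at h2
  exact h2

lemma unit_norm (e : Z5ˣ) : P g1 (e * cj e) * P g2 (e * cj e) = 1 := by
  have h : N (e : Z5) * N ((e⁻¹ : Z5ˣ) : Z5) = 1 := by
    rw [← N_mul, Units.mul_inv, N_one]
  have h1 := N_nonneg (e : Z5)
  have h2 := Int.eq_one_or_neg_one_of_mul_eq_one h
  have h3 : N (e : Z5) = 1 := by omega
  rw [← N_eq, h3]; simp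

lemma scale (s : ℝ) (hs : 0 < s) : ∃ e : Z5ˣ,
    1 ≤ s * P g1 (e * cj e) ∧ s * P g1 (e * cj e) < 2 + g1 := by
  have h1 : 1 < 2 + g1 := by linarith [g1_lb]
  have h0 : 0 < 2 + g1 := by linarith
  obtain ⟨n, hn1, hn2⟩ := exists_mem_Ico_zpow hs h1
  refine ⟨xi ^ (-n), ?_⟩
  rw [PN_xi_zpow g1 hg1, _root_.zpow_neg]
  have hp : 0 < (2 + g1) ^ n := zpow_pos h0 n
  rw [zpow_add_one₀ h0.ne'] at hn2
  constructor
  · rw [← div_eq_mul_inv, le_div_iff₀ hp]; linarith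
  · rw [← div_eq_mul_inv, div_lt_iff₀ hp]; linarith

/-- the unit of mixed sign -/
def u0 : Z5 := ⟨0, 0, 1, 1⟩
lemma isR_u0 : IsR u0 := ⟨rfl, rfl⟩
lemma P1_u0 : P g1 u0 = -1 - g1 := by simp [P, u0]; ring
lemma P2_u0 : P g2 u0 = g1 := by simp [P, u0, g2_eq]; ring

lemma class_neg {a : Z5} (ha : IsR a) (h1 : P g1 a < 0)
    (hn : P g1 a * P g2 a = 1) : ∃ e : Z5ˣ, a * (e * cj e) = -1 := by
  obtain ⟨e, he1, he2⟩ := scale (-P g1 a) (by linarith)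
  refine ⟨e, ?_⟩
  have hr := ha.mul (isR_norm (e : Z5))
  have m1 := P_mul hg1 ha (e * cj e)
  have m2 := P_mul hg2 ha (e * cj e)
  have he := unit_norm e
  have hp : P g1 (a * (e * cj e)) * P g2 (a * (e * cj e)) = 1 := by
    rw [m1, m2]; linear_combination hn * (P g1 (e * cj e) * P g2 (e * cj e)) + he
  have l1 : P g1 (a * (e * cj e)) ≤ -1 := by rw [m1]; linarith
  have l2 : -(2 + g1) < P g1 (a * (e * cj e)) := by rw [m1]; linarith
  generalize a * ((e : Z5) * cj e) = x at *
  obtain ⟨r1, r2⟩ := hr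
  have l3 : P g2 x < 0 := by nlinarith
  have l4 : -1 ≤ P g2 x := by nlinarith
  have l5 : P g2 x < -(1 - g1) := by
    by_contra hc
    push Not at hc
    have := hg1
    nlinarith [g1_lb, g1_ub]
  have hd : P g2 x - P g1 x = x.c * (1 + 2 * g1) := by
    simp only [P, g2_eq, r1, r2]; push_cast; ring
  have hc : x.c = 0 := by
    have c1 : (x.c : ℝ) < 1 := by nlinarith [g1_lb]
    have c2 : (-1 : ℝ) < x.c := by nlinarith [g1_lb]
    have c1' : x.c < 1 := by exact_mod_cast c1
    have c2' : -1 < x.c := by exact_mod_cast c2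
    omega
  have hP : P g1 x = x.a := by simp [P, r1, r2, hc]
  have hP2 : P g2 x = x.a := by simp [P, r1, r2, hc]
  rw [hP, hP2] at hp
  rw [hP] at l1
  have hp' : x.a * x.a = 1 := by exact_mod_cast hp
  have l1' : x.a ≤ -1 := by exact_mod_cast l1
  have : x.a = -1 := by nlinarith
  ext <;> simp [*]

lemma class_mix {a : Z5} (ha : IsR a) (h1 : P g1 a < 0)
    (hn : P g1 a * P g2 a = -1) : ∃ e : Z5ˣ, a * (e * cj e) = u0 := by
  obtain ⟨e, he1, he2⟩ := scale (-P g1 a) (by linarith)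
  refine ⟨e, ?_⟩
  have hr := ha.mul (isR_norm (e : Z5))
  have m1 := P_mul hg1 ha (e * cj e)
  have m2 := P_mul hg2 ha (e * cj e)
  have he := unit_norm e
  have hp : P g1 (a * (e * cj e)) * P g2 (a * (e * cj e)) = -1 := by
    rw [m1, m2]; linear_combination hn * (P g1 (e * cj e) * P g2 (e * cj e)) - he
  have l1 : P g1 (a * (e * cj e)) ≤ -1 := by rw [m1]; linarith
  have l2 : -(2 + g1) < P g1 (a * (e * cj e)) := by rw [m1]; linarith
  generalize a * ((e : Z5) * cj e) = x at *
  have hNm := PP hr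
  obtain ⟨r1, r2⟩ := hr
  have l3 : 0 < P g2 x := by nlinarith
  have l4 : P g2 x ≤ 1 := by nlinarith
  have hd : P g2 x - P g1 x = x.c * (1 + 2 * g1) := by
    simp only [P, g2_eq, r1, r2]; push_cast; ring
  have hc : x.c = 1 := by
    have c1 : (x.c : ℝ) < 2 := by nlinarith [g1_lb, g1_ub]
    have c2 : (0 : ℝ) < x.c := by nlinarith [g1_lb, g1_ub]
    have c1' : x.c < 2 := by exact_mod_cast c1
    have c2' : 0 < x.c := by exact_mod_cast c2
    omega
  have hP : P g1 x = x.a - 1 - g1 := by simp [P, r1, r2, hc]; ring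
  rw [hp] at hNm
  have hNm' : Nm x = -1 := by
    have : (Nm x : ℝ) = (-1 : ℤ) := by rw [← hNm]; simp
    exact_mod_cast this
  simp only [Nm, hc] at hNm'
  have l1' : x.a < 1 := by
    have : (x.a : ℝ) < 1 := by linarith [g1_ub]
    exact_mod_cast this
  have : x.a = 0 := by nlinarith
  ext <;> simp [*, u0]

/-- the hermitian form -/
def h (x y : Fin 3 → Z5) : Z5 := u0 * (x 0 * cj (y 0)) - x 1 * cj (y 1) - x 2 * cj (y 2)

lemma h_add_left (x y z : Fin 3 → Z5) : h (x + y) z = h x z + h y z := by simp [h]; ring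
lemma h_smul_left (c : Z5) (x z : Fin 3 → Z5) : h (c • x) z = c * h x z := by simp [h]; ring
lemma h_symm (x y : Fin 3 → Z5) : cj (h x y) = h y x := by
  have : cj u0 = u0 := (isR_iff _).1 isR_u0
  simp [h, this]; ring
lemma h_add_right (x y z : Fin 3 → Z5) : h z (x + y) = h z x + h z y := by simp [h]; ring
lemma h_smul_right (c : Z5) (x z : Fin 3 → Z5) : h z (c • x) = cj c * h z x := by simp [h]; ring
lemma isR_h (x : Fin 3 → Z5) : IsR (h x x) := by rw [isR_iff, h_symm]
lemma h_neg_def (x : Fin 3 → Z5) (hx : x ≠ 0) : P g1 (h x x) < 0 := by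
  have e : P g1 (h x x) = (-1 - g1) * P g1 (x 0 * cj (x 0)) - P g1 (x 1 * cj (x 1))
      - P g1 (x 2 * cj (x 2)) := by
    simp only [h, P_sub]; rw [P_mul hg1 isR_u0, P1_u0]
  have hg := g1_lb
  have n0 := P1_nonneg (x 0)
  have n1 := P1_nonneg (x 1)
  have n2 := P1_nonneg (x 2)
  by_cases h0 : x 0 = 0
  · by_cases h1 : x 1 = 0
    · by_cases h2 : x 2 = 0
      · exfalso; apply hx; funext i; fin_cases i <;> simp [h0, h1, h2]
      · have := P1_pos h2; nlinarith
    · have := P1_pos h1; nlinarith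
  · have := P1_pos h0; nlinarith

/-- Gram determinant -/
def gd (v w : Fin 3 → Z5) : Z5 := h v v * h w w - h v w * h w v
lemma isR_gd (v w : Fin 3 → Z5) : IsR (gd v w) := by
  rw [isR_iff]; simp [gd, h_symm]; ring

/-- a generating pair with unimodular Gram determinant of mixed sign -/
structure Good (K : Submodule Z5 (Fin 3 → Z5)) (v w : Fin 3 → Z5) : Prop where
  hv : v ∈ K
  hw : w ∈ K
  hs : ∀ k ∈ K, ∃ α β : Z5, k = α • v + β • w
  d1 : 0 < P g1 (gd v w)
  d2 : P g1 (gd v w) * P g2 (gd v w) = -1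

lemma Good.swap {K : Submodule Z5 (Fin 3 → Z5)} {v w : Fin 3 → Z5} (H : Good K v w) :
    Good K w v := by
  have e : gd w v = gd v w := by simp only [gd]; ring
  refine ⟨H.hw, H.hv, fun k hk => ?_, by rw [e]; exact H.d1, by rw [e]; exact H.d2⟩
  obtain ⟨α, β, rfl⟩ := H.hs k hk
  exact ⟨β, α, add_comm _ _⟩

lemma gd_move (v w : Fin 3 → Z5) (x e : Z5) : gd (x • v + e • w) v = (e * cj e) * gd v w := by
  simp only [gd, h_add_left, h_add_right, h_smul_left, h_smul_right]; ring

lemma Good.move {K : Submodule Z5 (Fin 3 → Z5)} {v w : Fin 3 → Z5} (H : Good K v w) (x : Z5)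
    (e : Z5ˣ) : Good K (x • v + (e : Z5) • w) v := by
  have m1 := P_mul hg1 (isR_norm (e : Z5)) (gd v w)
  have m2 := P_mul hg2 (isR_norm (e : Z5)) (gd v w)
  have he := unit_norm e
  refine ⟨K.add_mem (K.smul_mem _ H.hv) (K.smul_mem _ H.hw), H.hv, fun k hk => ?_, ?_, ?_⟩
  · obtain ⟨α, β, rfl⟩ := H.hs k hk
    have e1 : ((e⁻¹ : Z5ˣ) : Z5) * e = 1 := Units.inv_mul e
    refine ⟨β * (e⁻¹ : Z5ˣ), α - β * (e⁻¹ : Z5ˣ) * x, ?_⟩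
    funext i
    simp only [Pi.add_apply, Pi.smul_apply, smul_eq_mul]
    linear_combination (-β * w i) * e1
  · rw [gd_move, m1]; exact mul_pos (P1_pos e.ne_zero) H.d1
  · rw [gd_move, m1, m2]
    linear_combination he * (P g1 (gd v w) * P g2 (gd v w)) + H.d2

lemma Nm_gap (x : Z5) (h0 : Nm x ≠ 0) (h1 : (Nm x).natAbs ≠ 1) : 4 ≤ (Nm x).natAbs := by
  by_contra hc
  have hcase : Nm x = 2 ∨ Nm x = -2 ∨ Nm x = 3 ∨ Nm x = -3 := by omega
  simp only [Nm] at hcase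
  generalize x.a = a at hcase
  generalize x.c = c at hcase
  have m2 : (a * a - a * c - c * c) % 4 = ((a % 4) * (a % 4) - (a % 4) * (c % 4) - (c % 4) * (c % 4)) % 4 := by
    simp [Int.sub_emod, Int.mul_emod]
  have m3 : (a * a - a * c - c * c) % 9 = ((a % 9) * (a % 9) - (a % 9) * (c % 9) - (c % 9) * (c % 9)) % 9 := by
    simp [Int.sub_emod, Int.mul_emod]
  rcases hcase with e | e | e | e <;> rw [e] at m2 m3
  · have a1 : 0 ≤ a % 4 := by omega
    have a2 : a % 4 < 4 := by omega
    have c1 : 0 ≤ c % 4 := by omega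
    have c2 : c % 4 < 4 := by omega
    clear m3
    generalize a % 4 = r at *
    generalize c % 4 = t at *
    interval_cases r <;> interval_cases t <;> simp at m2
  · have a1 : 0 ≤ a % 4 := by omega
    have a2 : a % 4 < 4 := by omega
    have c1 : 0 ≤ c % 4 := by omega
    have c2 : c % 4 < 4 := by omega
    clear m3
    generalize a % 4 = r at *
    generalize c % 4 = t at *
    interval_cases r <;> interval_cases t <;> simp at m2
  · have a1 : 0 ≤ a % 9 := by omega
    have a2 : a % 9 < 9 := by omega
    have c1 : 0 ≤ c % 9 := by omega
    have c2 : c % 9 < 9 := by omega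
    clear m2
    generalize a % 9 = r at *
    generalize c % 9 = t at *
    interval_cases r <;> interval_cases t <;> simp at m3
  · have a1 : 0 ≤ a % 9 := by omega
    have a2 : a % 9 < 9 := by omega
    have c1 : 0 ≤ c % 9 := by omega
    have c2 : c % 9 < 9 := by omega
    clear m2
    generalize a % 9 = r at *
    generalize c % 9 = t at *
    interval_cases r <;> interval_cases t <;> simp at m3

/-- the size estimate behind the descent -/
lemma real_step (A1 A2 D1 D2 p1 p2 B1 B2 : ℝ) (hA1 : A1 < 0) (hA2 : A2 ≠ 0)
    (hm : 4 ≤ |A1 * A2|) (hD1 : 0 < D1) (hD : D1 * D2 = -1) (hp1 : 0 ≤ p1) (hp2 : 0 ≤ p2)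
    (hp : p1 + p2 ≤ 1) (hs1 : |A1| ≤ D1 * |A2|) (hs2 : D1 * |A2| ≤ 2.6181 * |A1|)
    (h1 : A1 * B1 = A1 ^ 2 * p1 + D1) (h2 : A2 * B2 = A2 ^ 2 * p2 + D2) :
    |B1 * B2| < |A1 * A2| := by
  have ha1 : 0 < |A1| := abs_pos.2 hA1.ne
  have ha2 : 0 < |A2| := abs_pos.2 hA2
  rw [abs_mul A1 A2] at *
  set a1 := |A1| with e1
  set a2 := |A2| with e2
  have s1 : A1 ^ 2 = a1 ^ 2 := (sq_abs A1).symm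
  have s2 : A2 ^ 2 = a2 ^ 2 := (sq_abs A2).symm
  rw [s1] at h1
  rw [s2] at h2
  set m := a1 * a2 with em
  have hD2 : D2 < 0 := by nlinarith
  have key : |(a1 ^ 2 * p1 + D1) * (a2 ^ 2 * p2 + D2)| < m ^ 2 := by
    have hX : 0 < a1 ^ 2 * p1 + D1 := by positivity
    have hpp : p1 * p2 ≤ 1 / 4 := by nlinarith [sq_nonneg (p1 - p2)]
    have hp1' : p1 ≤ 1 := by linarith
    have hp2' : p2 ≤ 1 := by linarith
    rw [abs_lt]
    constructor
    · have t1 : (a1 ^ 2 * p1 + D1) * D2 ≤ (a1 ^ 2 * p1 + D1) * (a2 ^ 2 * p2 + D2) :=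
        mul_le_mul_of_nonneg_left (by nlinarith [mul_nonneg (sq_nonneg a2) hp2]) hX.le
      have t2 : a1 ^ 2 * (-D2) ≤ m := by
        have : a1 * (-D2) ≤ a2 := by
          have := mul_le_mul_of_nonneg_right hs1 (show 0 ≤ -D2 by linarith)
          nlinarith
        nlinarith
      have t3 : (a1 ^ 2 * p1) * (-D2) ≤ m := by
        have : 0 ≤ a1 ^ 2 * (-D2) := mul_nonneg (sq_nonneg _) (by linarith)
        nlinarith
      nlinarith
    · have t1 : (a1 ^ 2 * p1 + D1) * (a2 ^ 2 * p2 + D2) ≤ (a1 ^ 2 * p1 + D1) * (a2 ^ 2 * p2) :=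
        mul_le_mul_of_nonneg_left (by linarith) hX.le
      have t2 : D1 * a2 ^ 2 ≤ 2.6181 * m := by nlinarith
      have t3 : D1 * a2 ^ 2 * p2 ≤ 2.6181 * m := by
        have : 0 ≤ D1 * a2 ^ 2 := by positivity
        nlinarith
      have t4 : (a1 ^ 2 * p1 + D1) * (a2 ^ 2 * p2) = m ^ 2 * (p1 * p2) + D1 * a2 ^ 2 * p2 := by
        rw [em]; ring
      have t5 : m ^ 2 * (p1 * p2) ≤ m ^ 2 * (1 / 4) :=
        mul_le_mul_of_nonneg_left hpp (sq_nonneg _)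
      nlinarith
  rw [← h1, ← h2] at key
  have e3 : A1 * B1 * (A2 * B2) = (A1 * A2) * (B1 * B2) := by ring
  rw [e3, abs_mul, abs_mul A1 A2, ← e1, ← e2, ← em] at key
  have hmpos : 0 < m := by positivity
  nlinarith

end Z5
namespace Z5

lemma Good.ne_zero {K : Submodule Z5 (Fin 3 → Z5)} {v w : Fin 3 → Z5} (H : Good K v w) :
    v ≠ 0 := by
  rintro rfl
  have := H.d1
  have e : gd 0 w = 0 := by simp [gd, h]
  rw [e, P_zero] at this
  exact lt_irrefl _ this

lemma h_ne_zero {v : Fin 3 → Z5} (hv : v ≠ 0) : h v v ≠ 0 := by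
  intro h0
  have := h_neg_def v hv
  rw [h0, P_zero] at this
  exact lt_irrefl _ this

lemma step {K : Submodule Z5 (Fin 3 → Z5)} {v w : Fin 3 → Z5} (H : Good K v w)
    (hm : (Nm (h v v)).natAbs ≠ 1) :
    ∃ v' w', Good K v' w' ∧ (Nm (h v' v')).natAbs < (Nm (h v v)).natAbs := by
  have hv := H.ne_zero
  have hA1 := h_neg_def v hv
  have ha0 := h_ne_zero hv
  have hr := isR_h v
  have hA2 : P g2 (h v v) ≠ 0 := fun h0 => ha0 (P2_eq_zero hr h0)
  have hPP := PP hr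
  have hn0 : Nm (h v v) ≠ 0 := by
    intro h0
    rw [h0, Int.cast_zero] at hPP
    exact mul_ne_zero hA1.ne hA2 hPP
  have h4 := Nm_gap _ hn0 hm
  have hd1 := H.d1
  obtain ⟨e, he1, he2⟩ := scale (P g1 (gd v w) * |P g2 (h v v)| / |P g1 (h v v)|)
    (div_pos (mul_pos hd1 (abs_pos.2 hA2)) (abs_pos.2 hA1.ne))
  obtain ⟨x, hx⟩ := cover' (tl (h v v) * (h w v * e)) (Nm (h v v)) hn0
  refine ⟨_, _, H.move x e, ?_⟩
  set v' := x • v + (e : Z5) • w with hv'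
  set n := Nm (h v v) with hn
  have hz : tl (h v v) * (h w v * e) + (n : ℤ) * x = tl (h v v) * h v' v := by
    rw [hn, ← mul_tl hr, hv', h_add_left, h_smul_left, h_smul_left]; ring
  rw [hz] at hx
  have hid : h v v * h v' v' = h v' v * cj (h v' v) + (e * cj e) * gd v w := by
    rw [h_symm, hv']
    simp only [gd, h_add_left, h_add_right, h_smul_left, h_smul_right]; ring
  have i1 := congrArg (P g1) hid
  have i2 := congrArg (P g2) hid
  rw [P_mul hg1 hr, P_add, P_mul hg1 (isR_norm (e : Z5))] at i1
  rw [P_mul hg2 hr, P_add, P_mul hg2 (isR_norm (e : Z5))] at i2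
  have z1 := Pn_mul hg1 (tl (h v v)) (h v' v)
  have z2 := Pn_mul hg2 (tl (h v v)) (h v' v)
  have ctl : cj (tl (h v v)) = tl (h v v) := (isR_iff _).1 (isR_tl _)
  have q1 : P g1 (tl (h v v) * cj (tl (h v v))) = P g2 (h v v) ^ 2 := by
    rw [ctl, P_mul hg1 (isR_tl _), P_tl1 hr]; ring
  have q2 : P g2 (tl (h v v) * cj (tl (h v v))) = P g1 (h v v) ^ 2 := by
    rw [ctl, P_mul hg2 (isR_tl _), P_tl2 hr]; ring
  rw [q1] at z1
  rw [q2] at z2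
  have hQ : (Q (tl (h v v) * h v' v) : ℝ) ≤ 2 * (n : ℝ) ^ 2 := by exact_mod_cast hx
  rw [Q_eq, z1, z2] at hQ
  have hPP' := PP (isR_h v')
  have c1 : (4 : ℝ) ≤ |P g1 (h v v) * P g2 (h v v)| := by
    rw [hPP]
    have : (4 : ℤ) ≤ |n| := by rw [Int.abs_eq_natAbs]; exact_mod_cast h4
    exact_mod_cast this
  have n1 := P1_nonneg (h v' v)
  have n2 := P2_nonneg (h v' v)
  have hE1 : 0 < P g1 ((e : Z5) * cj e) := P1_pos e.ne_zero
  have hE := unit_norm e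
  have hD := H.d2
  have hfin : |P g1 (h v' v') * P g2 (h v' v')| < |P g1 (h v v) * P g2 (h v v)| := by
    rw [← hPP] at hQ
    generalize P g1 (h v v) = A1 at *
    generalize P g2 (h v v) = A2 at *
    have hA1' : 0 < |A1| := abs_pos.2 hA1.ne
    refine real_step A1 A2 (P g1 (e * cj e) * P g1 (gd v w)) (P g2 (e * cj e) * P g2 (gd v w))
      (P g1 (h v' v * cj (h v' v)) / A1 ^ 2) (P g2 (h v' v * cj (h v' v)) / A2 ^ 2) _ _
      hA1 hA2 c1 (mul_pos hE1 hd1) ?_ (by positivity) (by positivity) ?_ ?_ ?_ ?_ ?_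
    · linear_combination hE * (P g1 (gd v w) * P g2 (gd v w)) + hD
    · have hA1n := hA1.ne
      rw [div_add_div _ _ (by positivity) (by positivity), div_le_one (by positivity)]
      nlinarith
    · rw [div_mul_eq_mul_div, le_div_iff₀ hA1'] at he1
      linarith
    · rw [div_mul_eq_mul_div, div_lt_iff₀ hA1'] at he2
      have := g1_ub
      nlinarith
    · have hA1n := hA1.ne
      rw [i1]; field_simp
    · rw [i2]; field_simp
  rw [hPP, hPP'] at hfin
  have : |Nm (h v' v')| < |n| := by exact_mod_cast hfin
  rw [Int.abs_eq_natAbs, Int.abs_eq_natAbs] at this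
  exact_mod_cast this

lemma reduce {K : Submodule Z5 (Fin 3 → Z5)} (m : ℕ) : ∀ v w : Fin 3 → Z5, Good K v w →
    (Nm (h v v)).natAbs = m → ∃ v' w', Good K v' w' ∧ (Nm (h v' v')).natAbs = 1 := by
  induction m using Nat.strong_induction_on with
  | _ m ih =>
    intro v w H hm
    by_cases h1 : (Nm (h v v)).natAbs = 1
    · exact ⟨v, w, H, h1⟩
    · obtain ⟨v', w', H', hlt⟩ := step H h1
      exact ih _ (by omega) v' w' H' rfl

lemma finish {K : Submodule Z5 (Fin 3 → Z5)} {v w : Fin 3 → Z5} (H : Good K v w)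
    (ho : h v w = 0) (hn : P g1 (h v v) * P g2 (h v v) = -1) :
    ∃ s ∈ K, ∃ t ∈ K, h s s = u0 ∧ h t t = -1 ∧ h s t = 0 ∧
      ∀ k ∈ K, ∃ α β : Z5, k = α • s + β • t := by
  have hg : gd v w = h v v * h w w := by simp [gd, ho]
  have hd1 := H.d1
  have hd2 := H.d2
  have hA := h_neg_def v H.ne_zero
  have hC := h_neg_def w H.swap.ne_zero
  rw [hg, P_mul hg1 (isR_h v)] at hd1 hd2
  rw [P_mul hg2 (isR_h v)] at hd2
  have hn2 : P g1 (h w w) * P g2 (h w w) = 1 := by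
    linear_combination (P g1 (h w w) * P g2 (h w w)) * hn - hd2
  obtain ⟨e, he⟩ := class_mix (isR_h v) hA hn
  obtain ⟨f, hf⟩ := class_neg (isR_h w) hC hn2
  refine ⟨(e : Z5) • v, K.smul_mem _ H.hv, (f : Z5) • w, K.smul_mem _ H.hw, ?_, ?_, ?_, ?_⟩
  · rw [h_smul_left, h_smul_right, ← he]; ring
  · rw [h_smul_left, h_smul_right, ← hf]; ring
  · rw [h_smul_left, h_smul_right, ho]; ring
  · intro k hk
    obtain ⟨α, β, rfl⟩ := H.hs k hk
    refine ⟨α * (e⁻¹ : Z5ˣ), β * (f⁻¹ : Z5ˣ), ?_⟩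
    rw [smul_smul, smul_smul, mul_assoc, mul_assoc, Units.inv_mul, Units.inv_mul, mul_one, mul_one]

lemma exists_pair {K : Submodule Z5 (Fin 3 → Z5)} {v w : Fin 3 → Z5} (H : Good K v w) :
    ∃ s ∈ K, ∃ t ∈ K, h s s = u0 ∧ h t t = -1 ∧ h s t = 0 ∧
      ∀ k ∈ K, ∃ α β : Z5, k = α • s + β • t := by
  obtain ⟨v, w, H, hm⟩ := reduce _ v w H rfl
  have hr := isR_h v
  have hmul := mul_tl hr
  have hsq : Nm (h v v) * Nm (h v v) = 1 := by
    rcases Int.natAbs_eq (Nm (h v v)) with e | e <;> rw [e, hm] <;> norm_num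
  have hsq' : ((Nm (h v v) : ℤ) : Z5) * ((Nm (h v v) : ℤ) : Z5) = 1 := by
    rw [← Int.cast_mul, hsq, Int.cast_one]
  have H2 := H.move (-(h w v * (tl (h v v) * (Nm (h v v) : ℤ)))) 1
  set w' := (-(h w v * (tl (h v v) * (Nm (h v v) : ℤ)))) • v + ((1 : Z5ˣ) : Z5) • w with hw'
  have ho : h w' v = 0 := by
    rw [hw', h_add_left, h_smul_left, h_smul_left, Units.val_one]
    linear_combination (-h w v * (Nm (h v v) : ℤ)) * hmul - h w v * hsq'
  have ho' : h v w' = 0 := by rw [← h_symm, ho, map_zero]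
  have hPP := PP hr
  rcases Int.natAbs_eq (Nm (h v v)) with e | e <;> rw [hm] at e
  · apply finish H2 ho
    have hd2 := H2.d2
    have hg : gd w' v = h w' w' * h v v := by simp [gd, ho]
    rw [hg, P_mul hg1 (isR_h w'), P_mul hg2 (isR_h w')] at hd2
    rw [e] at hPP
    push_cast at hPP
    linear_combination hd2 - P g1 (h w' w') * P g2 (h w' w') * hPP
  · apply finish H2.swap ho'
    rw [hPP, e]; simp

/-- linear functional `x ↦ h x r` -/
def hl (r : Fin 3 → Z5) : (Fin 3 → Z5) →ₗ[Z5] Z5 where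
  toFun x := h x r
  map_add' x y := h_add_left x y r
  map_smul' c x := h_smul_left c x r

lemma main_red (r : Fin 3 → Z5) (i : Z5) (hi : h r r * i = 1) (hneg : P g2 (h r r) < 0) :
    ∃ s t, h s r = 0 ∧ h t r = 0 ∧ h s s = u0 ∧ h t t = -1 ∧ h s t = 0 ∧
      ∀ k, h k r = 0 → ∃ α β : Z5, k = α • s + β • t := by
  have hsurj : Function.Surjective (hl r) := by
    intro y
    refine ⟨(y * i) • r, ?_⟩
    rw [map_smul]
    change (y * i) * h r r = y
    linear_combination y * hi
  have hfr : Module.finrank Z5 (LinearMap.ker (hl r)) = 2 := by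
    have := Submodule.finrank_quotient_add_finrank (LinearMap.ker (hl r))
    rw [((hl r).quotKerEquivOfSurjective hsurj).finrank_eq, Module.finrank_self,
      Module.finrank_fin_fun] at this
    omega
  let bs := Module.finBasisOfFinrankEq Z5 (LinearMap.ker (hl r)) hfr
  set v : Fin 3 → Z5 := (bs 0).1 with hv
  set w : Fin 3 → Z5 := (bs 1).1 with hw
  have hvK : h v r = 0 := (bs 0).2
  have hwK : h w r = 0 := (bs 1).2
  have hsp : ∀ k, h k r = 0 → ∃ α β : Z5, k = α • v + β • w := by
    intro k hk
    have hk' : k ∈ LinearMap.ker (hl r) := hk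
    have := bs.sum_repr ⟨k, hk'⟩
    rw [Fin.sum_univ_two] at this
    have h2 := congrArg Subtype.val this
    exact ⟨_, _, h2.symm⟩
  have hall : ∀ k : Fin 3 → Z5, ∃ c : Fin 3 → Z5, k = c 0 • r + c 1 • v + c 2 • w := by
    intro k
    obtain ⟨α, β, hab⟩ := hsp (k - (h k r * i) • r) (by
      have : k - (h k r * i) • r = k + (-(h k r * i)) • r := by rw [neg_smul]; abel
      rw [this, h_add_left, h_smul_left]; linear_combination -h k r * hi)
    refine ⟨![h k r * i, α, β], ?_⟩
    simp only [Matrix.cons_val]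
    rw [add_assoc, ← hab]; abel
  choose c hc using hall
  let Pm : Matrix (Fin 3) (Fin 3) Z5 := Matrix.of ![r, v, w]
  let Cm : Matrix (Fin 3) (Fin 3) Z5 := Matrix.of fun i => c (Pi.single i 1)
  have hCP : Cm * Pm = 1 := by
    ext1 i j
    have := congrFun (hc (Pi.single i 1)) j
    rw [Matrix.mul_apply, Fin.sum_univ_three, Matrix.one_eq_pi_single]
    rw [this]
    simp [Cm, Pm]
  have hdet : Cm.det * Pm.det = 1 := by rw [← Matrix.det_mul, hCP, Matrix.det_one]
  have hvr : h r v = 0 := by rw [← h_symm, hvK, map_zero]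
  have hwr : h r w = 0 := by rw [← h_symm, hwK, map_zero]
  have hgram : (Pm.det * cj Pm.det) * u0 = h r r * gd v w := by
    have e : (Pm.det * cj Pm.det) * u0 = h r r * gd v w
        - h r v * (h v r * h w w - h v w * h w r) + h r w * (h v r * h w v - h v v * h w r) := by
      simp only [Matrix.det_fin_three, gd, h, Pm]
      simp
      ring
    rw [e, hvr, hwr]; ring
  have hne : Pm.det ≠ 0 := by intro h0; rw [h0, mul_zero] at hdet; exact zero_ne_one hdet
  let pu : Z5ˣ := ⟨Pm.det, Cm.det, by rw [mul_comm]; exact hdet, hdet⟩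
  have hpu : P g1 (Pm.det * cj Pm.det) * P g2 (Pm.det * cj Pm.det) = 1 := unit_norm pu
  have j1 := congrArg (P g1) hgram
  have j2 := congrArg (P g2) hgram
  rw [P_mul hg1 (isR_norm _), P_mul hg1 (isR_h r), P1_u0] at j1
  rw [P_mul hg2 (isR_norm _), P_mul hg2 (isR_h r), P2_u0] at j2
  have hr0 : r ≠ 0 := by
    rintro rfl
    have : h 0 0 = 0 := by simp [h]
    rw [this, zero_mul] at hi
    exact zero_ne_one hi
  have hU1 := h_neg_def r hr0
  have hU : P g1 (h r r) * P g2 (h r r) = 1 := by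
    have hm := PP (isR_h r)
    have hpos : 0 < P g1 (h r r) * P g2 (h r r) := mul_pos_of_neg_of_neg hU1 hneg
    have hsq : N (h r r) = 1 := by
      have := N_nonneg (h r r)
      have h2 : N (h r r) * N i = 1 := by rw [← N_mul, hi, N_one]
      have := Int.eq_one_or_neg_one_of_mul_eq_one h2
      omega
    have hsq' : (N (h r r) : ℝ) = 1 := by rw [hsq]; simp
    have cr : cj (h r r) = h r r := (isR_iff _).1 (isR_h r)
    rw [N_eq, cr, P_mul hg1 (isR_h r), P_mul hg2 (isR_h r)] at hsq'
    nlinarith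
  have hd1 : 0 < P g1 (Pm.det * cj Pm.det) := P1_pos hne
  have G0 : Good (LinearMap.ker (hl r)) v w := by
    refine ⟨hvK, hwK, fun k hk => hsp k hk, ?_, ?_⟩
    · have := g1_lb
      by_contra hcon
      push Not at hcon
      nlinarith [mul_nonneg_of_nonpos_of_nonpos hU1.le hcon, mul_pos hd1 (show 0 < 1 + g1 by linarith)]
    · have hgg : (-1 - g1) * g1 = -1 := by linear_combination -hg1
      calc P g1 (gd v w) * P g2 (gd v w)
          = (P g1 (h r r) * P g1 (gd v w)) * (P g2 (h r r) * P g2 (gd v w)) := by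
            linear_combination (-(P g1 (gd v w) * P g2 (gd v w))) * hU
        _ = -1 := by
            rw [← j1, ← j2]
            linear_combination ((-1 - g1) * g1) * hpu + hgg
  obtain ⟨s, hs, t, ht, a1, a2, a3, a4⟩ := exists_pair G0
  exact ⟨s, t, hs, ht, a1, a2, a3, fun k hk => a4 k hk⟩

end Z5
namespace Z5

/-- the functional with `⟨x, y⟩ = L (h x y)` -/
def L (z : Z5) : ℤ := 2 * z.a - z.b

lemma L_nondeg (z : Z5) (h0 : L z = 0) (h1 : L (⟨0, 1, 0, 0⟩ * z) = 0)
    (h2 : L (⟨0, 0, 1, 0⟩ * z) = 0) (h3 : L (⟨0, 0, 0, 1⟩ * z) = 0) : z = 0 := by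
  simp [L] at h0 h1 h2 h3
  ext <;> simp <;> omega

/-- the identification of `ℤ[ζ₅]³` with `T` -/
def Phi (x : Fin 3 → Z5) : Fin 12 → ℤ :=
  ![(x 0).a + (x 0).c - (x 0).d, -(x 0).b + (x 0).c + (x 0).d, -(x 0).d, (x 0).c,
    (x 1).a, (x 1).b, (x 1).c, (x 1).d, (x 2).a, (x 2).b, (x 2).c, (x 2).d]

/-- the inverse of `Phi` -/
def Psi (v : Fin 12 → ℤ) : Fin 3 → Z5 :=
  ![⟨v 0 - v 2 - v 3, -v 1 - v 2 + v 3, v 3, -v 2⟩, ⟨v 4, v 5, v 6, v 7⟩, ⟨v 8, v 9, v 10, v 11⟩]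

lemma Phi_Psi (v : Fin 12 → ℤ) : Phi (Psi v) = v := by
  funext i
  fin_cases i <;> simp [Phi, Psi] <;> ring

lemma Psi_Phi (x : Fin 3 → Z5) : Psi (Phi x) = x := by
  funext i
  fin_cases i <;> ext <;> simp [Phi, Psi]

lemma Phi_add (x y : Fin 3 → Z5) : Phi (x + y) = Phi x + Phi y := by
  funext i
  fin_cases i <;> simp [Phi] <;> ring

lemma Phi_zero : Phi 0 = 0 := by
  funext i
  fin_cases i <;> simp [Phi]

lemma Phi_int (n : ℤ) (x : Fin 3 → Z5) : Phi ((n : Z5) • x) = n • Phi x := by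
  funext i
  fin_cases i <;> simp [Phi] <;> ring

lemma Phi_zeta (x : Fin 3 → Z5) : Phi ((⟨0, 1, 0, 0⟩ : Z5) • x) = ρ.mulVec (Phi x) := by
  funext i
  fin_cases i <;> simp [Phi, ρ, Matrix.mulVec, dotProduct, Fin.sum_univ_succ] <;> ring

lemma B_Phi (x y : Fin 3 → Z5) : B (Phi x) (Phi y) = L (h x y) := by
  simp only [B, Phi, G, Matrix.mulVec, dotProduct, Fin.sum_univ_succ, L, h, u0]
  simp
  ring

lemma B_add_left (u v w : Fin 12 → ℤ) : B (u + v) w = B u w + B v w := by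
  simp [B, add_dotProduct]

lemma B_sum_left {k : ℕ} (c : Fin k → ℤ) (r : Fin k → (Fin 12 → ℤ)) (w : Fin 12 → ℤ) :
    B (∑ i, c i • r i) w = ∑ i, c i * B (r i) w := by
  simp only [B, sum_dotProduct, smul_dotProduct, smul_eq_mul]

lemma B_sum_right {k : ℕ} (c : Fin k → ℤ) (r : Fin k → (Fin 12 → ℤ)) (w : Fin 12 → ℤ) :
    B w (∑ i, c i • r i) = ∑ i, c i * B w (r i) := by
  simp only [B, Matrix.mulVec_sum, dotProduct_sum, Matrix.mulVec_smul, dotProduct_smul, smul_eq_mul]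

lemma decomp (c : Z5) (x : Fin 3 → Z5) : c • x = (c.a : Z5) • x
    + (c.b : Z5) • ((⟨0, 1, 0, 0⟩ : Z5) • x)
    + (c.c : Z5) • ((⟨0, 1, 0, 0⟩ : Z5) • ((⟨0, 1, 0, 0⟩ : Z5) • x))
    + (c.d : Z5) • ((⟨0, 1, 0, 0⟩ : Z5) • ((⟨0, 1, 0, 0⟩ : Z5) • ((⟨0, 1, 0, 0⟩ : Z5) • x))) := by
  simp only [smul_smul, ← add_smul]
  congr 1
  ext <;> simp

/-- coefficients of the standard basis of `U ⊕ V` -/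
def al : Fin 8 → Z5 :=
  ![⟨1, 0, 0, 0⟩, ⟨0, -1, 0, 0⟩, ⟨-1, -1, 0, -1⟩, ⟨-1, 1, 1, 0⟩, 0, 0, 0, 0]
/-- coefficients of the standard basis of `A₄` -/
def be : Fin 8 → Z5 :=
  ![0, 0, 0, 0, ⟨1, 0, 0, 0⟩, ⟨0, 1, 0, 0⟩, ⟨0, 0, 1, 0⟩, ⟨0, 0, 0, 1⟩]

lemma gram8 : ∀ i j, L (al i * cj (al j) * u0 - be i * cj (be j)) = G₈ i j := by
  intro i j
  fin_cases i <;> fin_cases j <;> rfl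

/-- the root `r` generates a unimodular rank one lattice -/
lemma root_cases (R : Submodule ℤ (Fin 12 → ℤ)) (x : Fin 3 → Z5) (hx : Phi x ∈ R)
    (hR : ∀ (c : Z5) (y : Fin 3 → Z5), Phi y ∈ R → Phi (c • y) ∈ R)
    (hdef : ∀ v ∈ R, 0 ≤ B v v → v = 0) (h2 : B (Phi x) (Phi x) = -2) :
    h x x = -1 ∨ h x x = ⟨-1, 0, 1, 1⟩ := by
  obtain ⟨r1, r2⟩ := isR_h x
  have hx0 : x ≠ 0 := by
    rintro rfl
    rw [Phi_zero] at h2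
    simp [B] at h2
  have hp := h2
  rw [B_Phi] at hp
  simp only [L, r1] at hp
  have hz : ∀ c : Z5, c ≠ 0 → L (c * (cj c * h x x)) < 0 := by
    intro c hc
    by_contra hcon
    push Not at hcon
    have := hdef _ (hR c x hx) (by rw [B_Phi, h_smul_left, h_smul_right]; exact hcon)
    have h3 : c • x = 0 := by
      rw [← Psi_Phi (c • x), this, ← Phi_zero, Psi_Phi]
    rcases smul_eq_zero.1 h3 with h4 | h4
    · exact hc h4
    · exact hx0 h4
  have z1 := hz ⟨1, 1, 0, 0⟩ (fun e => by simpa using congrArg Z5.a e)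
  have z2 := hz ⟨1, 0, 1, 0⟩ (fun e => by simpa using congrArg Z5.a e)
  simp [L, r1, r2] at z1 z2
  have hc : (h x x).c = 0 ∨ (h x x).c = 1 := by omega
  rcases hc with hc | hc
  · left; ext <;> simp [*] ; omega
  · right; ext <;> simp [*] ; omega

lemma gram_det (u : Z5) (hu : u = -1 ∨ u = ⟨-1, 0, 1, 1⟩) (z : Fin 4 → Z5)
    (hz : z = ![⟨1, 0, 0, 0⟩, ⟨0, 1, 0, 0⟩, ⟨0, 0, 1, 0⟩, ⟨0, 0, 0, 1⟩]) :
    (Matrix.of fun i j => L (z i * (cj (z j) * u)) : Matrix (Fin 4) (Fin 4) ℤ).det ≠ 0 := by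
  subst hz
  rcases hu with rfl | rfl
  · have : (Matrix.of fun i j => L ((![⟨1, 0, 0, 0⟩, ⟨0, 1, 0, 0⟩, ⟨0, 0, 1, 0⟩, ⟨0, 0, 0, 1⟩] :
        Fin 4 → Z5) i * (cj ((![⟨1, 0, 0, 0⟩, ⟨0, 1, 0, 0⟩, ⟨0, 0, 1, 0⟩, ⟨0, 0, 0, 1⟩] :
        Fin 4 → Z5) j) * -1)) : Matrix (Fin 4) (Fin 4) ℤ)
        = !![-2, 1, 0, 0; 1, -2, 1, 0; 0, 1, -2, 1; 0, 0, 1, -2] := by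
      ext i j; fin_cases i <;> fin_cases j <;> rfl
    rw [this]; decide
  · have : (Matrix.of fun i j => L ((![⟨1, 0, 0, 0⟩, ⟨0, 1, 0, 0⟩, ⟨0, 0, 1, 0⟩, ⟨0, 0, 0, 1⟩] :
        Fin 4 → Z5) i * (cj ((![⟨1, 0, 0, 0⟩, ⟨0, 1, 0, 0⟩, ⟨0, 0, 1, 0⟩, ⟨0, 0, 0, 1⟩] :
        Fin 4 → Z5) j) * ⟨-1, 0, 1, 1⟩)) : Matrix (Fin 4) (Fin 4) ℤ)
        = !![-2, 0, 1, 1; 0, -2, 0, 1; 1, 0, -2, 0; 1, 1, 0, -2] := by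
      ext i j; fin_cases i <;> fin_cases j <;> rfl
    rw [this]; decide

end Z5
open Z5 in
theorem stmt6 (r : Fin 4 → (Fin 12 → ℤ))
    (R : Submodule ℤ (Fin 12 → ℤ))
    (hbasis : LinearIndependent ℤ r)
    (hspan : R = Submodule.span ℤ (Set.range r))
    (hgram : ∀ i j, B (r i) (r j) = A4gram i j)
    (hinv : Submodule.map ρ.mulVecLin R = R) :
    -- `T = R ⊕ R^⊥`:
    (∀ v : Fin 12 → ℤ, ∃ a ∈ R, ∃ b : Fin 12 → ℤ, (∀ w ∈ R, B b w = 0) ∧ v = a + b) ∧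
    (∀ a ∈ R, (∀ w ∈ R, B a w = 0) → a = 0) ∧
    -- `R^⊥ ≅ U ⊕ V ⊕ A₄`:
    (∃ s : Fin 8 → (Fin 12 → ℤ),
      (∀ i, ∀ w ∈ R, B (s i) w = 0) ∧
      LinearIndependent ℤ s ∧
      (∀ v : Fin 12 → ℤ, (∀ w ∈ R, B v w = 0) →
        v ∈ Submodule.span ℤ (Set.range s)) ∧
      (∀ i j, B (s i) (s j) = G₈ i j)) := by
  have hρ : ∀ v ∈ R, ρ.mulVec v ∈ R := by
    intro v hv
    have : ρ.mulVecLin v ∈ Submodule.map ρ.mulVecLin R := Submodule.mem_map_of_mem hv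
    rw [hinv] at this
    exact this
  have hR : ∀ (c : Z5) (y : Fin 3 → Z5), Phi y ∈ R → Phi (c • y) ∈ R := by
    intro c y hy
    rw [decomp c y]
    simp only [Phi_add, Phi_int, Phi_zeta]
    have k1 := hρ _ hy
    have k2 := hρ _ k1
    have k3 := hρ _ k2
    exact R.add_mem (R.add_mem (R.add_mem (R.smul_mem _ hy) (R.smul_mem _ k1)) (R.smul_mem _ k2))
      (R.smul_mem _ k3)
  have hco : ∀ v ∈ R, ∃ c : Fin 4 → ℤ, v = ∑ i, c i • r i := by
    intro v hv
    rw [hspan, Submodule.mem_span_range_iff_exists_fun] at hv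
    obtain ⟨c, hc⟩ := hv
    exact ⟨c, hc.symm⟩
  have hdef : ∀ v ∈ R, 0 ≤ B v v → v = 0 := by
    intro v hv h0
    obtain ⟨c, rfl⟩ := hco v hv
    simp only [B_sum_left, B_sum_right, hgram] at h0
    simp [Fin.sum_univ_four, A4gram] at h0
    have e0 : c 0 = 0 := by
      have : c 0 ^ 2 = 0 := by
        nlinarith [sq_nonneg (c 0), sq_nonneg (c 0 - c 1), sq_nonneg (c 1 - c 2), sq_nonneg (c 2 - c 3), sq_nonneg (c 3)]
      simpa using this
    have e1 : c 3 = 0 := by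
      have : c 3 ^ 2 = 0 := by
        nlinarith [sq_nonneg (c 0), sq_nonneg (c 0 - c 1), sq_nonneg (c 1 - c 2), sq_nonneg (c 2 - c 3), sq_nonneg (c 3)]
      simpa using this
    rw [e0, e1] at h0
    have e2 : c 1 = 0 := by
      have : c 1 ^ 2 = 0 := by
        nlinarith [sq_nonneg (c 1), sq_nonneg (c 1 - c 2), sq_nonneg (c 2)]
      simpa using this
    have e3 : c 2 = 0 := by
      have : c 2 ^ 2 = 0 := by
        nlinarith [sq_nonneg (c 1), sq_nonneg (c 1 - c 2), sq_nonneg (c 2)]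
      simpa using this
    simp [Fin.sum_univ_four, e0, e1, e2, e3]
  set x := Psi (r 0) with hxdef
  have hx : Phi x ∈ R := by
    rw [hxdef, Phi_Psi, hspan]; exact Submodule.subset_span ⟨0, rfl⟩
  have hB : B (Phi x) (Phi x) = -2 := by
    rw [hxdef, Phi_Psi, hgram]; simp [A4gram]
  have hcase := root_cases R x hx hR hdef hB
  obtain ⟨i, hi, hneg⟩ : ∃ i, h x x * i = 1 ∧ P g2 (h x x) < 0 := by
    rcases hcase with e | e
    · refine ⟨-1, by rw [e]; ring, ?_⟩
      rw [e, P_neg, P_one]; norm_num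
    · refine ⟨⟨-2, 0, -1, -1⟩, by rw [e]; ext <;> simp, ?_⟩
      rw [e, g2_eq]; simp [P]; linarith [g1_ub]
  have hgen : ∀ y, Phi y ∈ R → h y x = 0 → y = 0 := by
    intro y hy hyx
    obtain ⟨c, hc⟩ := hco _ hy
    let z : Fin 4 → Z5 := ![⟨1, 0, 0, 0⟩, ⟨0, 1, 0, 0⟩, ⟨0, 0, 1, 0⟩, ⟨0, 0, 0, 1⟩]
    have hw : ∀ j, ∃ d : Fin 4 → ℤ, Phi (z j • x) = ∑ i, d i • r i := fun j => hco _ (hR _ _ hx)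
    choose C hC using hw
    have hdet := gram_det (h x x) hcase z rfl
    have hM : (Matrix.of fun i j => L (z i * (cj (z j) * h x x)) : Matrix (Fin 4) (Fin 4) ℤ)
        = Matrix.of C * A4gram * (Matrix.of C)ᵀ := by
      ext i j
      have : B (Phi (z i • x)) (Phi (z j • x)) = L (z i * (cj (z j) * h x x)) := by
        rw [B_Phi, h_smul_left, h_smul_right]
      rw [Matrix.of_apply, ← this, hC, hC, B_sum_left]
      simp only [B_sum_right, hgram]
      simp only [Matrix.mul_apply, Matrix.transpose_apply, Matrix.of_apply, Fin.sum_univ_four]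
      ring
    rw [hM, Matrix.det_mul] at hdet
    have hdet' := left_ne_zero_of_mul hdet
    have hmv : (Matrix.of C * A4gram).mulVec c = 0 := by
      funext j
      have hxy : h x y = 0 := by rw [← h_symm, hyx, map_zero]
      have : B (Phi (z j • x)) (Phi y) = 0 := by
        rw [B_Phi, h_smul_left, hxy]; simp [L]
      rw [hC, hc, B_sum_left] at this
      simp only [B_sum_right, hgram] at this
      simp only [Fin.sum_univ_four] at this
      simp only [Matrix.mulVec, dotProduct, Matrix.mul_apply, Matrix.of_apply, Fin.sum_univ_four,
        Pi.zero_apply]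
      linarith
    have hc0 := Matrix.eq_zero_of_mulVec_eq_zero hdet' hmv
    rw [hc0] at hc
    have : Phi y = Phi 0 := by rw [hc, Phi_zero]; simp
    rw [← Psi_Phi y, this, Psi_Phi]
  have hproj : ∀ y : Fin 3 → Z5, h (y + (-(h y x * i)) • x) x = 0 := by
    intro y
    rw [h_add_left, h_smul_left]; linear_combination (-h y x) * hi
  have hRx : ∀ w ∈ R, ∃ α : Z5, w = Phi (α • x) := by
    intro w hw
    refine ⟨h (Psi w) x * i, ?_⟩
    have h1 : Phi (Psi w + (-(h (Psi w) x * i)) • x) ∈ R := by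
      rw [Phi_add, Phi_Psi]; exact R.add_mem hw (hR _ _ hx)
    have h2 := hgen _ h1 (hproj _)
    have h3 : Psi w = (h (Psi w) x * i) • x := by
      rw [neg_smul] at h2
      exact add_neg_eq_zero.1 h2
    rw [← h3, Phi_Psi]
  have hperp : ∀ y, h y x = 0 → ∀ w ∈ R, B (Phi y) w = 0 := by
    intro y hy w hw
    obtain ⟨α, rfl⟩ := hRx w hw
    rw [B_Phi, h_smul_right, hy]; simp [L]
  have hperp' : ∀ v, (∀ w ∈ R, B v w = 0) → h (Psi v) x = 0 := by
    intro v hv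
    have key : ∀ c : Z5, L (c * h (Psi v) x) = 0 := by
      intro c
      have := hv _ (hR (cj c) x hx)
      rw [← Phi_Psi v, B_Phi, h_smul_right, cj_cj] at this
      exact this
    refine L_nondeg _ ?_ (key _) (key _) (key _)
    have := key 1
    rwa [one_mul] at this
  refine ⟨fun v => ?_, fun a ha hw => hdef a ha (hw a ha).ge, ?_⟩
  · refine ⟨Phi ((h (Psi v) x * i) • x), hR _ _ hx, Phi (Psi v + (-(h (Psi v) x * i)) • x),
      hperp _ (hproj _), ?_⟩
    rw [← Phi_add]
    conv_lhs => rw [← Phi_Psi v]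
    congr 1
    rw [neg_smul]; abel
  obtain ⟨s, t, hs, ht, hss, htt, hst, hgenst⟩ := main_red x i hi hneg
  have hts : h t s = 0 := by rw [← h_symm, hst, map_zero]
  have hG : ∀ i j, B (Phi (al i • s + be i • t)) (Phi (al j • s + be j • t)) = G₈ i j := by
    intro i j
    rw [B_Phi, ← gram8 i j]
    congr 1
    simp only [h_add_left, h_add_right, h_smul_left, h_smul_right, hss, htt, hst, hts]
    ring
  refine ⟨fun i => Phi (al i • s + be i • t), ?_, ?_, ?_, hG⟩
  · intro i
    apply hperp
    rw [h_add_left, h_smul_left, h_smul_left, hs, ht]; ring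
  · rw [Fintype.linearIndependent_iff]
    intro c hc
    have key : ∀ j, ∑ i, c i * G₈ i j = 0 := by
      intro j
      have := B_sum_left c (fun i => Phi (al i • s + be i • t)) (Phi (al j • s + be j • t))
      rw [hc] at this
      simp only [hG] at this
      rw [← this]; simp [B]
    have k0 := key 0
    have k1 := key 1
    have k2 := key 2
    have k3 := key 3
    have k4 := key 4
    have k5 := key 5
    have k6 := key 6
    have k7 := key 7
    simp [Fin.sum_univ_succ, G₈] at k0 k1 k2 k3 k4 k5 k6 k7
    intro i
    fin_cases i <;> simp <;> omega
  · intro v hv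
    obtain ⟨α, β, hab⟩ := hgenst _ (hperp' v hv)
    rw [Submodule.mem_span_range_iff_exists_fun]
    let n : Fin 8 → ℤ := ![α.a + α.c - α.d, -α.b + α.c + α.d, -α.d, α.c, β.a, β.b, β.c, β.d]
    refine ⟨n, ?_⟩
    have e1 : ∑ j, (n j : Z5) * al j = α := by
      ext <;> simp [Fin.sum_univ_succ, n, al] <;> ring
    have e2 : ∑ j, (n j : Z5) * be j = β := by
      ext <;> simp [Fin.sum_univ_succ, n, be]
    rw [← Phi_Psi v, hab]
    simp only [← Phi_int]
    let F : (Fin 3 → Z5) →+ (Fin 12 → ℤ) := ⟨⟨Phi, Phi_zero⟩, Phi_add⟩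
    have hF : ∀ f : Fin 8 → (Fin 3 → Z5), ∑ j, Phi (f j) = Phi (∑ j, f j) :=
      fun f => (map_sum F f Finset.univ).symm
    rw [hF]
    congr 1
    simp only [smul_add, smul_smul, Finset.sum_add_distrib, ← Finset.sum_smul, e1, e2]
end

section
/- Let Γ = { φ ∈ GL(12,ℤ) : φᵀGφ = G and φρ = ρφ } and Γ' = { φ ∈ Γ : (φ − id)·G⁻¹ has integer entries } (i.e. Γ' consists of those φ ∈ Γ acting trivially on the discriminant group T*/T). Then Γ' is a normal subgroup of Γ and the quotient group Γ/Γ' is isomorphic to (ℤ/2ℤ) × S₅, where S₅ is the symmetric group on 5 letters; in particular Γ/Γ' is isomorphic to the orthogonal group O(3,𝔽₅). -/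
open Matrix

private abbrev Mat := Matrix (Fin 12) (Fin 12) ℤ

/-- `Γ = { φ ∈ GL(12,ℤ) : φᵀGφ = G, φρ = ρφ }`, the group of isometries of the
lattice `T` commuting with `ρ`. -/
def Γ : Subgroup Matˣ where
  carrier := {φ | (φ : Mat)ᵀ * G * (φ : Mat) = G ∧ (φ : Mat) * ρ = ρ * (φ : Mat)}
  one_mem' := by
    constructor
    · rw [Units.val_one, Matrix.transpose_one, Matrix.one_mul, Matrix.mul_one]
    · rw [Units.val_one, Matrix.one_mul, Matrix.mul_one]
  mul_mem' := by
    rintro a b ⟨ha1, ha2⟩ ⟨hb1, hb2⟩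
    set A : Mat := (a : Mat)
    set Bm : Mat := (b : Mat)
    have hab : ((a * b : Matˣ) : Mat) = A * Bm := Units.val_mul a b
    constructor
    · show ((a * b : Matˣ) : Mat)ᵀ * G * ((a * b : Matˣ) : Mat) = G
      calc ((a * b : Matˣ) : Mat)ᵀ * G * ((a * b : Matˣ) : Mat)
          = (A * Bm)ᵀ * G * (A * Bm) := by rw [hab]
        _ = Bmᵀ * (Aᵀ * G * A) * Bm := by
            rw [Matrix.transpose_mul]; simp only [Matrix.mul_assoc]
        _ = G := by rw [ha1, hb1]
    · show ((a * b : Matˣ) : Mat) * ρ = ρ * ((a * b : Matˣ) : Mat)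
      calc ((a * b : Matˣ) : Mat) * ρ = A * (Bm * ρ) := by rw [hab, Matrix.mul_assoc]
        _ = A * ρ * Bm := by rw [hb2, Matrix.mul_assoc]
        _ = ρ * ((a * b : Matˣ) : Mat) := by rw [ha2, hab, Matrix.mul_assoc]
  inv_mem' := by
    rintro a ⟨ha1, ha2⟩
    set A : Mat := (a : Mat)
    set Ai : Mat := ((a⁻¹ : Matˣ) : Mat)
    have hmi : A * Ai = 1 := a.mul_inv
    have him : Ai * A = 1 := a.inv_mul
    constructor
    · show Aiᵀ * G * Ai = G
      calc Aiᵀ * G * Ai = Aiᵀ * (Aᵀ * G * A) * Ai := by rw [ha1]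
        _ = (A * Ai)ᵀ * G * (A * Ai) := by
            rw [Matrix.transpose_mul]; simp only [Matrix.mul_assoc]
        _ = G := by rw [hmi, Matrix.transpose_one, Matrix.one_mul, Matrix.mul_one]
    · show Ai * ρ = ρ * Ai
      calc Ai * ρ = Ai * ρ * (A * Ai) := by rw [hmi, Matrix.mul_one]
        _ = Ai * (ρ * A) * Ai := by simp only [Matrix.mul_assoc]
        _ = Ai * (A * ρ) * Ai := by rw [← ha2]
        _ = Ai * A * (ρ * Ai) := by simp only [Matrix.mul_assoc]
        _ = ρ * Ai := by rw [him, Matrix.one_mul]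

/-- The condition that `φ ∈ Γ` acts trivially on the discriminant group `T*/T`,
i.e. `(φ − 1)·G⁻¹` is an integer matrix. -/
def trivialOnDiscriminant (φ : Γ) : Prop :=
  ∀ i j, ∃ n : ℤ,
    ((((φ : Matˣ) : Mat).map (Int.cast : ℤ → ℚ) - 1) *
      (G.map (Int.cast : ℤ → ℚ))⁻¹) i j = (n : ℚ)

/-- Columns: a basis of the kernel of `G` modulo 5. -/
def auxW : Matrix (Fin 12) (Fin 3) ℤ :=
  !![0, 0, 0;
     0, 0, 0;
     1, 0, 0;
     3, 0, 0;
     0, 2, 2;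
     0, 4, 4;
     0, 1, 1;
     0, 3, 3;
     0, 2, 3;
     0, 4, 1;
     0, 1, 4;
     0, 3, 2]

/-- A left inverse of `auxW` modulo 5. -/
def auxP : Matrix (Fin 3) (Fin 12) ℤ :=
  !![0, 0, 1, 0, 0, 0, 0, 0, 0, 0, 0, 0;
     0, 0, 0, 0, 4, 0, 0, 0, 4, 0, 0, 0;
     0, 0, 0, 0, 4, 0, 0, 0, 1, 0, 0, 0]

/-- `G * auxW = 5 * auxY`. -/
def auxY : Matrix (Fin 12) (Fin 3) ℤ :=
  !![0, 0, 0;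
     0, 0, 0;
     1, 0, 0;
     -1, 0, 0;
     0, 0, 0;
     0, -1, -1;
     0, 1, 1;
     0, -1, -1;
     0, 0, -1;
     0, -1, 1;
     0, 1, -1;
     0, -1, 0]

/-- `1 - auxW * auxP = auxQ * G`. -/
def auxQ : Matrix (Fin 12) (Fin 12) ℤ :=
  !![0, 1, 0, 0, 0, 0, 0, 0, 0, 0, 0, 0;
     1, 0, 0, 0, 0, 0, 0, 0, 0, 0, 0, 0;
     0, 0, 0, 0, 0, 0, 0, 0, 0, 0, 0, 0;
     0, 0, -1, -1, 0, 0, 0, 0, 0, 0, 0, 0;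
     0, 0, 0, 0, 12, 9, 6, 3, 8, 6, 4, 2;
     0, 0, 0, 0, 25, 18, 12, 6, 16, 12, 8, 4;
     0, 0, 0, 0, 6, 4, 2, 1, 4, 3, 2, 1;
     0, 0, 0, 0, 19, 14, 9, 4, 12, 9, 6, 3;
     0, 0, 0, 0, 16, 12, 8, 4, 8, 6, 4, 2;
     0, 0, 0, 0, 16, 12, 8, 4, 13, 9, 6, 3;
     0, 0, 0, 0, 16, 12, 8, 4, 6, 4, 2, 1;
     0, 0, 0, 0, 16, 12, 8, 4, 11, 8, 5, 2]

/-- `5 * auxP = auxS * G`. -/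
def auxS : Matrix (Fin 3) (Fin 12) ℤ :=
  !![0, 0, 2, 1, 0, 0, 0, 0, 0, 0, 0, 0;
     0, 0, 0, 0, -16, -12, -8, -4, -16, -12, -8, -4;
     0, 0, 0, 0, -16, -12, -8, -4, -4, -3, -2, -1]

/-- `5` times the inverse of `G`. -/
def auxN : Matrix (Fin 12) (Fin 12) ℤ :=
  !![0, 5, 0, 0, 0, 0, 0, 0, 0, 0, 0, 0;
     5, 0, 0, 0, 0, 0, 0, 0, 0, 0, 0, 0;
     0, 0, 2, 1, 0, 0, 0, 0, 0, 0, 0, 0;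
     0, 0, 1, -2, 0, 0, 0, 0, 0, 0, 0, 0;
     0, 0, 0, 0, -4, -3, -2, -1, 0, 0, 0, 0;
     0, 0, 0, 0, -3, -6, -4, -2, 0, 0, 0, 0;
     0, 0, 0, 0, -2, -4, -6, -3, 0, 0, 0, 0;
     0, 0, 0, 0, -1, -2, -3, -4, 0, 0, 0, 0;
     0, 0, 0, 0, 0, 0, 0, 0, -4, -3, -2, -1;
     0, 0, 0, 0, 0, 0, 0, 0, -3, -6, -4, -2;
     0, 0, 0, 0, 0, 0, 0, 0, -2, -4, -6, -3;
     0, 0, 0, 0, 0, 0, 0, 0, -1, -2, -3, -4]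

/-- An isometry commuting with `ρ`. -/
def auxA : Matrix (Fin 12) (Fin 12) ℤ :=
  !![2, 1, -1, -3, 1, 0, 0, 1, 0, 0, 0, 0;
     1, 0, -2, -1, 0, 0, -1, 2, 0, 0, 0, 0;
     0, 1, 2, 0, 1, -1, 1, -1, 0, 0, 0, 0;
     1, 0, -1, -1, 0, 0, 0, 1, 0, 0, 0, 0;
     0, -1, -1, 0, -1, 1, -1, 0, 0, 0, 0, 0;
     0, -1, 0, 1, 0, 0, 0, -1, 0, 0, 0, 0;
     0, -1, -1, 1, 0, 1, -1, 0, 0, 0, 0, 0;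
     -1, -1, 0, 2, -1, 1, 0, -1, 0, 0, 0, 0;
     0, 0, 0, 0, 0, 0, 0, 0, 1, 0, 0, 0;
     0, 0, 0, 0, 0, 0, 0, 0, 0, 1, 0, 0;
     0, 0, 0, 0, 0, 0, 0, 0, 0, 0, 1, 0;
     0, 0, 0, 0, 0, 0, 0, 0, 0, 0, 0, 1]

/-- The inverse of `auxA`. -/
def auxAi : Matrix (Fin 12) (Fin 12) ℤ :=
  !![0, 1, 2, 1, 1, 0, 0, 1, 0, 0, 0, 0;
     1, 2, 1, -2, 0, 0, -1, 2, 0, 0, 0, 0;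
     -1, -1, 1, 2, 1, -1, 1, -1, 0, 0, 0, 0;
     0, 1, 1, 0, 0, 0, 0, 1, 0, 0, 0, 0;
     0, -1, -1, 0, -1, 0, 1, -1, 0, 0, 0, 0;
     0, -1, 0, 1, 0, -1, 1, 0, 0, 0, 0, 0;
     0, -1, -1, 1, -1, 0, 0, 0, 0, 0, 0, 0;
     -1, -1, 0, 2, 0, -1, 1, -1, 0, 0, 0, 0;
     0, 0, 0, 0, 0, 0, 0, 0, 1, 0, 0, 0;
     0, 0, 0, 0, 0, 0, 0, 0, 0, 1, 0, 0;
     0, 0, 0, 0, 0, 0, 0, 0, 0, 0, 1, 0;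
     0, 0, 0, 0, 0, 0, 0, 0, 0, 0, 0, 1]

/-- An isometry commuting with `ρ`. -/
def auxC : Matrix (Fin 12) (Fin 12) ℤ :=
  !![2, 2, 1, -2, -1, 2, -2, 2, -2, 1, 0, 0;
     2, 2, -1, -3, -2, 2, -2, 1, -1, 0, 0, -1;
     -1, 0, 3, 2, 2, -1, 0, 1, 0, 1, -1, 1;
     1, 1, 0, -1, -1, 1, -1, 1, -1, 0, 0, 0;
     0, 0, -1, 0, -1, 1, 0, -1, 0, 0, 0, 0;
     -1, 0, 0, 1, 0, 0, 1, -1, 0, 0, 0, 0;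
     0, 1, 0, -1, -1, 1, 0, 0, 0, 0, 0, 0;
     0, 0, -1, -1, -1, 0, 1, -1, 0, 0, 0, 0;
     1, 1, 0, -1, -1, 1, -1, 1, -1, 1, 0, -1;
     0, 0, -1, 0, -1, 0, 0, 0, 0, 0, 1, -1;
     0, 1, 1, 0, 0, 0, -1, 1, -1, 1, 0, 0;
     1, 1, -1, -2, -1, 1, -1, 0, -1, 0, 1, -1]

/-- The inverse of `auxC`. -/
def auxCi : Matrix (Fin 12) (Fin 12) ℤ :=
  !![2, 2, 1, -2, 0, 1, -2, 1, -2, 2, -1, -1;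
     2, 2, -1, -3, -1, 2, -1, 0, -2, 1, 1, -2;
     -1, 0, 3, 2, 1, -1, 0, 1, 0, 1, -2, 2;
     1, 1, 0, -1, 0, 1, -1, 0, -1, 1, 0, -1;
     1, 0, -2, -2, -1, 1, 0, -1, 0, -1, 1, -1;
     0, -1, -1, 0, 0, 0, 1, -1, 1, -1, 0, 0;
     1, 0, -1, -1, -1, 1, 0, 0, 0, 0, 0, -1;
     0, -1, -2, 0, -1, 0, 1, -1, 1, -1, 1, -1;
     1, 1, 0, -2, 0, 0, 0, 0, -1, 1, 0, -1;
     1, 0, -1, -2, 0, 0, 0, 0, 0, 0, 1, -1;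
     1, 0, 0, -1, 0, 0, 0, 0, -1, 1, 0, 0;
     1, 0, -1, -1, 0, 0, 0, 0, -1, 0, 1, -1]

theorem auxGW : G * auxW = (5 : ℤ) • auxY := by decide +kernel
theorem auxQG : (1 : Matrix (Fin 12) (Fin 12) ℤ) = auxW * auxP + auxQ * G := by decide +kernel
theorem auxSG : (5 : ℤ) • auxP = auxS * G := by decide +kernel
theorem auxGN : G * auxN = (5 : ℤ) • (1 : Matrix (Fin 12) (Fin 12) ℤ) := by decide +kernel

/-- Reduction modulo 5. -/
def red5 {m n : Type*} (A : Matrix m n ℤ) : Matrix m n (ZMod 5) :=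
  A.map (Int.castRingHom (ZMod 5))

theorem red5_mul {l m n : Type*} [Fintype m] (A : Matrix l m ℤ) (C : Matrix m n ℤ) :
    red5 (A * C) = red5 A * red5 C := Matrix.map_mul

theorem red5_add {m n : Type*} (A C : Matrix m n ℤ) :
    red5 (A + C) = red5 A + red5 C := by
  ext i j; simp [red5]

theorem red5_sub {m n : Type*} (A C : Matrix m n ℤ) :
    red5 (A - C) = red5 A - red5 C := by
  ext i j; simp [red5]

theorem red5_five {m n : Type*} (A : Matrix m n ℤ) : red5 ((5 : ℤ) • A) = 0 := by
  ext i j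
  have : (5 : ZMod 5) = 0 := by decide
  simp [red5, this]

theorem red5_transpose {m n : Type*} (A : Matrix m n ℤ) : red5 Aᵀ = (red5 A)ᵀ := rfl

theorem exists_of_red5 {m n : Type*} (A : Matrix m n ℤ) (h : red5 A = 0) :
    ∃ X : Matrix m n ℤ, A = (5 : ℤ) • X := by
  have : ∀ i j, ∃ x : ℤ, A i j = 5 * x := by
    intro i j
    have h1 := congrFun (congrFun h i) j
    simp only [red5, Matrix.map_apply, Matrix.zero_apply, eq_intCast] at h1
    exact (ZMod.intCast_zmod_eq_zero_iff_dvd _ 5).1 h1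
  choose X hX using this
  exact ⟨Matrix.of X, by ext i j; rw [hX i j]; rfl⟩

theorem auxPW : red5 auxP * red5 auxW = 1 := by decide +kernel
theorem auxWY : red5 auxWᵀ * red5 auxY = (3 : ZMod 5) • 1 := by decide +kernel
theorem auxWG : red5 auxWᵀ * red5 G = 0 := by decide +kernel

/-- Elements of `Γ` preserve the kernel of `G` modulo 5. -/
theorem aux_lift (φ : Γ) :
    ∃ X : Matrix (Fin 12) (Fin 3) ℤ, ((φ : Matˣ) : Mat) * auxW =
      auxW * (auxP * ((φ : Matˣ) : Mat) * auxW) + (5 : ℤ) • X := by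
  set A : Mat := ((φ : Matˣ) : Mat) with hA
  set C : Mat := (((φ : Matˣ)⁻¹ : Matˣ) : Mat) with hC
  have h1 : A * C = 1 := (φ : Matˣ).mul_inv
  have h2 : Cᵀ * Aᵀ = 1 := by rw [← Matrix.transpose_mul, h1, Matrix.transpose_one]
  have hG : Aᵀ * G * A = G := φ.2.1
  have h3 : G * A = Cᵀ * G := by
    rw [← hG, ← Matrix.mul_assoc, ← Matrix.mul_assoc, h2, Matrix.one_mul, hG]
  refine ⟨auxQ * Cᵀ * auxY, ?_⟩
  calc A * auxW = (1 : Mat) * (A * auxW) := by rw [Matrix.one_mul]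
    _ = auxW * (auxP * A * auxW) + auxQ * (G * A) * auxW := by
      rw [auxQG, Matrix.add_mul]; simp only [Matrix.mul_assoc]
    _ = _ := by
      rw [h3, ← Matrix.mul_smul, ← auxGW]; simp only [Matrix.mul_assoc]

/-- The action on the discriminant group, as a 3 by 3 matrix. -/
def actM (φ : Γ) : Matrix (Fin 3) (Fin 3) (ZMod 5) := red5 (auxP * ((φ : Matˣ) : Mat) * auxW)

theorem act_W (φ : Γ) : red5 ((φ : Matˣ) : Mat) * red5 auxW = red5 auxW * actM φ := by
  obtain ⟨X, hX⟩ := aux_lift φ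
  rw [← red5_mul, hX, red5_add, red5_five, add_zero, red5_mul, actM]

theorem act_eq (φ : Γ) : actM φ = red5 auxP * red5 ((φ : Matˣ) : Mat) * red5 auxW := by
  rw [actM, red5_mul, red5_mul]

theorem act_one : actM 1 = 1 := by
  have : red5 (1 : Mat) = 1 := by simp [red5]
  rw [act_eq]
  change red5 auxP * red5 (1 : Mat) * red5 auxW = 1
  rw [this, Matrix.mul_one, auxPW]

theorem act_mul (φ ψ : Γ) : actM (φ * ψ) = actM φ * actM ψ := by
  rw [act_eq]
  have : (((φ * ψ : Γ) : Matˣ) : Mat) = ((φ : Matˣ) : Mat) * ((ψ : Matˣ) : Mat) := rfl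
  rw [this, red5_mul, Matrix.mul_assoc, Matrix.mul_assoc, act_W, ← Matrix.mul_assoc,
    ← Matrix.mul_assoc, act_eq φ]

theorem act_orth (φ : Γ) : (actM φ)ᵀ * actM φ = 1 := by
  obtain ⟨X, hX⟩ := aux_lift φ
  set A : Mat := ((φ : Matˣ) : Mat) with hA
  have hG : Aᵀ * G * A = G := φ.2.1
  have h1 : Aᵀ * (auxY * (auxP * A * auxW) + G * X) = auxY := by
    have : (5 : ℤ) • (Aᵀ * (auxY * (auxP * A * auxW) + G * X)) = (5 : ℤ) • auxY := by
      calc (5 : ℤ) • (Aᵀ * (auxY * (auxP * A * auxW) + G * X))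
          = Aᵀ * (((5 : ℤ) • auxY) * (auxP * A * auxW) + G * ((5 : ℤ) • X)) := by
            rw [← Matrix.mul_smul, smul_add, Matrix.smul_mul, Matrix.mul_smul]
        _ = Aᵀ * (G * (A * auxW)) := by
            rw [hX, ← auxGW, Matrix.mul_add G, Matrix.mul_assoc G]
        _ = (5 : ℤ) • auxY := by
            rw [← auxGW]
            simp only [← Matrix.mul_assoc]
            rw [hG]
    exact smul_right_injective _ (by norm_num : (5 : ℤ) ≠ 0) this
  have h2 : red5 auxWᵀ * red5 (Aᵀ * (auxY * (auxP * A * auxW) + G * X)) =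
      red5 auxWᵀ * red5 auxY := by rw [h1]
  rw [red5_mul Aᵀ, red5_add, ← Matrix.mul_assoc] at h2
  have h3 : red5 auxWᵀ * red5 Aᵀ = (actM φ)ᵀ * red5 auxWᵀ := by
    rw [red5_transpose, red5_transpose, ← Matrix.transpose_mul, act_W, Matrix.transpose_mul]
  rw [h3, Matrix.mul_add, red5_mul auxY, red5_mul G, Matrix.mul_assoc (actM φ)ᵀ,
    Matrix.mul_assoc (actM φ)ᵀ, ← Matrix.mul_assoc (red5 auxWᵀ), ← Matrix.mul_assoc (red5 auxWᵀ),
    auxWY, auxWG, Matrix.zero_mul, Matrix.mul_zero, add_zero, Matrix.smul_mul, Matrix.one_mul,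
    Matrix.mul_smul] at h2
  have h4 := congrArg (fun Z => (2 : ZMod 5) • Z) h2
  simp only [smul_smul] at h4
  have h5 : (2 * 3 : ZMod 5) = 1 := by decide
  rw [h5, one_smul, one_smul] at h4
  exact h4

theorem triv_iff (φ : Γ) : trivialOnDiscriminant φ ↔
    ∃ Z : Mat, ((φ : Matˣ) : Mat) - 1 = Z * G := by
  set A : Mat := ((φ : Matˣ) : Mat) with hA
  let c : ∀ {m n : Type} (_ : Matrix m n ℤ), Matrix m n ℚ := fun X => X.map (Int.castRingHom ℚ)
  have hdet : IsUnit (c G).det := by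
    have h1 : c G * c auxN = (5 : ℚ) • 1 := by
      have := congrArg (fun X => X.map (Int.castRingHom ℚ)) auxGN
      simp only [Matrix.map_mul] at this
      rw [this]
      ext i j
      rw [Matrix.map_apply, Matrix.smul_apply, Matrix.smul_apply, Matrix.one_apply,
        Matrix.one_apply]
      split_ifs <;> simp
    have h2 : c G * ((5 : ℚ)⁻¹ • c auxN) = 1 := by
      rw [Matrix.mul_smul, h1, smul_smul]; norm_num
    exact Matrix.isUnit_det_of_right_inverse h2
  have hsub : (A.map (Int.cast : ℤ → ℚ) - 1) = c (A - 1) := by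
    ext i j
    simp [c, Matrix.one_apply]
  have hGc : G.map (Int.cast : ℤ → ℚ) = c G := rfl
  constructor
  · intro h
    unfold trivialOnDiscriminant at h
    choose Z hZ using h
    refine ⟨Matrix.of Z, ?_⟩
    have h1 : c (A - 1) * (c G)⁻¹ = c (Matrix.of Z) := by
      ext i j
      rw [← hsub, ← hGc, hZ i j]; rfl
    have h2 : c (A - 1) = c (Matrix.of Z * G) := by
      have : c (Matrix.of Z * G) = c (Matrix.of Z) * c G := Matrix.map_mul
      rw [this, ← h1, Matrix.mul_assoc, Matrix.nonsing_inv_mul _ hdet, Matrix.mul_one]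
    ext i j
    have := congrFun (congrFun h2 i) j
    simp only [c, Matrix.map_apply, eq_intCast, Int.cast_inj] at this
    exact this
  · rintro ⟨Z, hZ⟩ i j
    refine ⟨Z i j, ?_⟩
    have : c (Z * G) = c Z * c G := Matrix.map_mul
    rw [hsub, hGc, hZ, this, Matrix.mul_assoc, Matrix.mul_nonsing_inv _ hdet, Matrix.mul_one]
    rfl

theorem act_eq_one_iff (φ : Γ) : actM φ = 1 ↔ trivialOnDiscriminant φ := by
  rw [triv_iff]
  set A : Mat := ((φ : Matˣ) : Mat) with hA
  constructor
  · intro h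
    have h1 : red5 ((A - 1) * auxW) = 0 := by
      rw [Matrix.sub_mul, red5_sub, red5_mul, act_W, h, Matrix.one_mul, Matrix.mul_one, sub_self]
    obtain ⟨X, hX⟩ := exists_of_red5 _ h1
    refine ⟨X * auxS + (A - 1) * auxQ, ?_⟩
    calc A - 1 = (A - 1) * 1 := by rw [Matrix.mul_one]
      _ = (A - 1) * auxW * auxP + (A - 1) * auxQ * G := by
        rw [auxQG, Matrix.mul_add, ← auxQG]; simp only [Matrix.mul_assoc]
      _ = _ := by
        rw [hX, Matrix.add_mul, Matrix.smul_mul, ← Matrix.mul_smul, auxSG, Matrix.mul_assoc X]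
  · rintro ⟨Z, hZ⟩
    have h1 : A = 1 + Z * G := by rw [← hZ]; abel
    have h2 : A * auxW = auxW + (5 : ℤ) • (Z * auxY) := by
      rw [h1, Matrix.add_mul, Matrix.one_mul, Matrix.mul_assoc, auxGW, Matrix.mul_smul]
    rw [actM, Matrix.mul_assoc, h2, red5_mul, red5_add, red5_five, add_zero, auxPW]

/-- The homomorphism from `Γ` to the orthogonal group. -/
def actHom : Γ →* Matrix.orthogonalGroup (Fin 3) (ZMod 5) where
  toFun φ := ⟨actM φ, (Matrix.mem_orthogonalGroup_iff' _ _).2 (act_orth φ)⟩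
  map_one' := Subtype.ext act_one
  map_mul' φ ψ := Subtype.ext (act_mul φ ψ)

/-- Orthonormal basis of the heart of the permutation module of `S₅` modulo 5. -/
def auxU : Matrix (Fin 5) (Fin 3) (ZMod 5) :=
  !![-2, -2, -2; 0, 0, 0; 0, 1, 1; 1, 0, 1; 1, 1, 0]

/-- The representation of `S₅`. -/
def repM (σ : Equiv.Perm (Fin 5)) : Matrix (Fin 3) (Fin 3) (ZMod 5) :=
  Matrix.of fun i j => ∑ k, auxU (σ k) i * auxU k j

/-- all ones column -/
def auxJ : Matrix (Fin 5) (Fin 1) (ZMod 5) := Matrix.of fun _ _ => 1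

theorem repM_eq (σ : Equiv.Perm (Fin 5)) :
    repM σ = auxUᵀ * Matrix.permMatrixHom (R := ZMod 5) σ * auxU := by
  ext i j
  rw [Matrix.mul_apply]
  simp only [repM, Matrix.of_apply]
  refine Finset.sum_congr rfl fun k _ => ?_
  congr 1
  rw [Matrix.mul_apply]
  simp [PEquiv.toMatrix_apply, Equiv.symm_apply_eq]

theorem perm_mul_J (σ : Equiv.Perm (Fin 5)) :
    Matrix.permMatrixHom (R := ZMod 5) σ * auxJ = auxJ := by
  ext i j
  simp [Matrix.mul_apply, auxJ, PEquiv.toMatrix_apply]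

theorem J_mul_perm (σ : Equiv.Perm (Fin 5)) :
    auxJᵀ * Matrix.permMatrixHom (R := ZMod 5) σ = auxJᵀ := by
  ext i j
  simp [Matrix.mul_apply, auxJ, PEquiv.toMatrix_apply, Equiv.symm_apply_eq]

/-- row vector in the decomposition of `1 - U Uᵀ` -/
def auxL : Matrix (Fin 1) (Fin 5) (ZMod 5) := !![0, 1, 0, 0, 0]

/-- column vector in the decomposition of `1 - U Uᵀ` -/
def auxR : Matrix (Fin 5) (Fin 1) (ZMod 5) := !![4; 0; 4; 4; 4]

theorem auxU_decomp :
    (1 : Matrix (Fin 5) (Fin 5) (ZMod 5)) = auxU * auxUᵀ + auxJ * auxL + auxR * auxJᵀ := by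
  decide +kernel

theorem auxUU : auxUᵀ * auxU = 1 := by decide +kernel
theorem auxUJ : auxUᵀ * auxJ = 0 := by decide +kernel
theorem auxJU : auxJᵀ * auxU = 0 := by decide +kernel

theorem repM_one : repM 1 = 1 := by
  rw [repM_eq, map_one, Matrix.mul_one, auxUU]

theorem repM_mul (σ τ : Equiv.Perm (Fin 5)) : repM (σ * τ) = repM σ * repM τ := by
  rw [repM_eq, repM_eq, repM_eq, map_mul]
  set S := Matrix.permMatrixHom (R := ZMod 5) σ with hS
  set T := Matrix.permMatrixHom (R := ZMod 5) τ with hT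
  have h1 : S * auxJ = auxJ := perm_mul_J σ
  have h2 : auxJᵀ * T = auxJᵀ := J_mul_perm τ
  calc auxUᵀ * (S * T) * auxU = auxUᵀ * (S * (1 * T)) * auxU := by rw [Matrix.one_mul]
    _ = auxUᵀ * S * auxU * (auxUᵀ * T * auxU) + auxUᵀ * (S * auxJ) * (auxL * T * auxU)
        + auxUᵀ * S * auxR * (auxJᵀ * T * auxU) := by
      rw [auxU_decomp]
      simp only [Matrix.mul_add, Matrix.add_mul, Matrix.mul_assoc]
    _ = _ := by
      rw [h1, h2, auxUJ, auxJU, Matrix.zero_mul, Matrix.mul_zero, add_zero, add_zero]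

theorem repM_transpose (σ : Equiv.Perm (Fin 5)) : (repM σ)ᵀ = repM σ⁻¹ := by
  ext i j
  simp only [repM, Matrix.transpose_apply, Matrix.of_apply]
  rw [← Equiv.sum_comp σ⁻¹]
  refine Finset.sum_congr rfl fun k _ => ?_
  rw [show σ (σ⁻¹ k) = k from σ.apply_symm_apply k, mul_comm]

/-- The sign character with values in `ZMod 5`. -/
def sg (a : Multiplicative (ZMod 2)) : ZMod 5 := if a = 1 then 1 else -1

theorem sg_mul (a b : Multiplicative (ZMod 2)) : sg (a * b) = sg a * sg b := by
  revert a b; decide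

theorem sg_sq (a : Multiplicative (ZMod 2)) : sg a * sg a = 1 := by
  revert a; decide

/-- The homomorphism from `ℤ/2 × S₅` to the orthogonal group. -/
def repHom : Multiplicative (ZMod 2) × Equiv.Perm (Fin 5) →*
    Matrix.orthogonalGroup (Fin 3) (ZMod 5) where
  toFun x := ⟨sg x.1 • repM x.2, (Matrix.mem_orthogonalGroup_iff' _ _).2 (by
    rw [Matrix.transpose_smul, repM_transpose, Matrix.smul_mul, Matrix.mul_smul, smul_smul, sg_sq,
      one_smul, ← repM_mul, inv_mul_cancel, repM_one])⟩
  map_one' := Subtype.ext (by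
    change sg 1 • repM 1 = 1
    rw [repM_one]
    simp [sg])
  map_mul' x y := Subtype.ext (by
    change sg (x.1 * y.1) • repM (x.2 * y.2) = (sg x.1 • repM x.2) * (sg y.1 • repM y.2)
    rw [sg_mul, repM_mul, Matrix.smul_mul, Matrix.mul_smul, smul_smul])

theorem rep_ker : ∀ (a : Multiplicative (ZMod 2)) (σ : Equiv.Perm (Fin 5)),
    sg a • repM σ = 1 → a = 1 ∧ σ = 1 := by
  decide +kernel

theorem repHom_injective : Function.Injective repHom := by
  rw [injective_iff_map_eq_one]
  rintro ⟨a, σ⟩ h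
  have h1 : sg a • repM σ = 1 := congrArg Subtype.val h
  have := rep_ker a σ h1
  rw [this.1, this.2]; rfl

theorem rep_trans : ∀ a b c : ZMod 5, a * a + b * b + c * c = 1 →
    ∃ (s : Multiplicative (ZMod 2)) (σ : Equiv.Perm (Fin 5)),
      sg s * repM σ 0 0 = a ∧ sg s * repM σ 1 0 = b ∧ sg s * repM σ 2 0 = c := by
  decide +kernel

theorem rep_stab : ∀ a b : ZMod 5, a * a + b * b = 1 → ∀ c d : ZMod 5, c * c + d * d = 1 →
    a * c + b * d = 0 →
    ∃ (s : Multiplicative (ZMod 2)) (σ : Equiv.Perm (Fin 5)),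
      sg s • repM σ = !![1, 0, 0; 0, a, c; 0, b, d] := by
  decide +kernel

theorem repHom_surjective : Function.Surjective repHom := by
  intro A
  have orth : ∀ X : Matrix.orthogonalGroup (Fin 3) (ZMod 5), ∀ i j,
      X.1 0 i * X.1 0 j + X.1 1 i * X.1 1 j + X.1 2 i * X.1 2 j =
        (1 : Matrix (Fin 3) (Fin 3) (ZMod 5)) i j := by
    intro X i j
    have h := (Matrix.mem_orthogonalGroup_iff' _ _).1 X.2
    rw [← h, Matrix.mul_apply, Fin.sum_univ_three]
    rfl
  obtain ⟨s, σ, h0, h1, h2⟩ := rep_trans _ _ _ (orth A 0 0)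
  set h := repHom (s, σ) with hh
  have hcol : ∀ i, h.1 i 0 = A.1 i 0 := by
    intro i
    fin_cases i
    · exact h0
    · exact h1
    · exact h2
  set C := h⁻¹ * A with hC
  have hC0 : ∀ i, C.1 i 0 = (1 : Matrix (Fin 3) (Fin 3) (ZMod 5)) i 0 := by
    intro i
    have e1 : C.1 = (h⁻¹).1 * A.1 := rfl
    have e2 : (h⁻¹).1 * h.1 = 1 := congrArg Subtype.val (inv_mul_cancel h)
    rw [e1, ← e2, Matrix.mul_apply, Matrix.mul_apply]
    simp only [hcol]
  have c00 : C.1 0 0 = 1 := hC0 0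
  have c10 : C.1 1 0 = 0 := hC0 1
  have c20 : C.1 2 0 = 0 := hC0 2
  have o01 := orth C 0 1
  have o02 := orth C 0 2
  have o11 := orth C 1 1
  have o12 := orth C 1 2
  have o22 := orth C 2 2
  rw [c00, c10, c20] at o01 o02
  have c01 : C.1 0 1 = 0 := by simpa using o01
  have c02 : C.1 0 2 = 0 := by simpa using o02
  rw [c01] at o11 o12
  rw [c02] at o22 o12
  obtain ⟨t, τ, ht⟩ := rep_stab (C.1 1 1) (C.1 2 1) (by simpa using o11) (C.1 1 2) (C.1 2 2)
    (by simpa using o22) (by simpa using o12)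
  have hCt : repHom (t, τ) = C := by
    apply Subtype.ext
    refine ht.trans ?_
    ext i j
    fin_cases i <;> fin_cases j <;> simp [c00, c10, c20, c01, c02]
  refine ⟨(s, σ) * (t, τ), ?_⟩
  rw [map_mul, hCt, hC, ← hh, mul_inv_cancel_left]

/-- `ℤ/2 × S₅ ≅ O(3, 𝔽₅)` -/
noncomputable def repEquiv : Multiplicative (ZMod 2) × Equiv.Perm (Fin 5) ≃*
    Matrix.orthogonalGroup (Fin 3) (ZMod 5) :=
  MulEquiv.ofBijective repHom ⟨repHom_injective, repHom_surjective⟩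

/-- First element of `Γ`, mapping to a transposition. -/
def γA : Γ := ⟨⟨auxA, auxAi, by decide +kernel, by decide +kernel⟩,
  ⟨by decide +kernel, by decide +kernel⟩⟩

/-- Second element of `Γ`, mapping to a 5-cycle. -/
def γC : Γ := ⟨⟨auxC, auxCi, by decide +kernel, by decide +kernel⟩,
  ⟨by decide +kernel, by decide +kernel⟩⟩

/-- The element `-1` of `Γ`. -/
def γN : Γ := ⟨⟨-1, -1, by decide +kernel, by decide +kernel⟩,
  ⟨by decide +kernel, by decide +kernel⟩⟩

theorem act_γA : actHom γA = repHom (1, Equiv.swap 0 1) :=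
  Subtype.ext (by
    change red5 (auxP * auxA * auxW) = sg 1 • repM (Equiv.swap 0 1)
    decide +kernel)

theorem act_γC : actHom γC = repHom (1, finRotate 5) :=
  Subtype.ext (by
    change red5 (auxP * auxC * auxW) = sg 1 • repM (finRotate 5)
    decide +kernel)

theorem act_γN : actHom γN = repHom (Multiplicative.ofAdd 1, 1) :=
  Subtype.ext (by
    change red5 (auxP * (-1) * auxW) = sg (Multiplicative.ofAdd 1) • repM 1
    decide +kernel)

theorem actHom_surjective : Function.Surjective actHom := by
  let H : Subgroup (Equiv.Perm (Fin 5)) :=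
    actHom.range.comap (repHom.comp (MonoidHom.inr (Multiplicative (ZMod 2)) _))
  have hH : H = ⊤ := by
    have h := Equiv.Perm.closure_cycle_adjacent_swap (isCycle_finRotate (n := 3))
      support_finRotate (0 : Fin 5)
    rw [eq_top_iff, ← h, Subgroup.closure_le]
    rintro x (rfl | rfl)
    · exact ⟨γC, act_γC⟩
    · exact ⟨γA, act_γA⟩
  intro X
  obtain ⟨⟨a, σ⟩, rfl⟩ := repHom_surjective X
  have h1 : σ ∈ H := by rw [hH]; trivial
  obtain ⟨φ, hφ⟩ := h1
  have h2 : actHom φ = repHom (1, σ) := hφ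
  have h3 : a = 1 ∨ a = Multiplicative.ofAdd 1 := by revert a; decide
  rcases h3 with rfl | rfl
  · exact ⟨φ, h2⟩
  · refine ⟨γN * φ, ?_⟩
    rw [map_mul, h2, act_γN, ← map_mul, Prod.mk_mul_mk, one_mul, mul_one]

/-- The subgroup `Γ' ⊆ Γ` of isometries acting trivially on the discriminant group
is a normal subgroup, and `Γ/Γ' ≅ ℤ/2 × S₅ ≅ O(3, 𝔽₅)`: there is a surjective
homomorphism `Γ → ℤ/2 × S₅` whose kernel is exactly `Γ'`. -/
theorem stmt14 :
    (∃ f : Γ →* Multiplicative (ZMod 2) × Equiv.Perm (Fin 5),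
      Function.Surjective f ∧ ∀ φ : Γ, f φ = 1 ↔ trivialOnDiscriminant φ) ∧
    Nonempty ((Multiplicative (ZMod 2) × Equiv.Perm (Fin 5)) ≃*
      Matrix.orthogonalGroup (Fin 3) (ZMod 5)) := by
  refine ⟨⟨repEquiv.symm.toMonoidHom.comp actHom, ?_, ?_⟩, ⟨repEquiv⟩⟩
  · exact repEquiv.symm.surjective.comp actHom_surjective
  · intro φ
    rw [← act_eq_one_iff]
    change repEquiv.symm (actHom φ) = 1 ↔ _
    rw [map_eq_one_iff _ repEquiv.symm.injective]
    exact Subtype.ext_iff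
end
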